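/- arXiv:2310.13272 — 5 statements merged into one kernel-verified Lean document; each statement's English description precedes it below -/
import Mathlib

section
/- For g ≥ 1, the subgroup H of the hyperelliptic mapping class group H_g generated by h_1 = t_{α_1} t_{α_2}^{-1} t_{α_3} t_{α_4}^{-1} ⋯ t_{α_{2g-1}} t_{α_{2g}}^{-1} t_{α_{2g+1}} and h_2 = t_{α_2}^{-1} t_{α_3} t_{α_4}^{-1} ⋯ t_{α_{2g-1}} t_{α_{2g}}^{-1} t_{α_{2g+1}} is all of H_g. -/
namespace HumphriesStmt8

variable {M : Type} [Group M] {Curve : Type}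

/-- The product `t_{α_{2i-1}} t_{α_{2i}}⁻¹ t_{α_{2i+1}} t_{α_{2i+2}}⁻¹ ⋯ t_{α_{2g-1}} t_{α_{2g}}⁻¹`. -/
def oddTail (tw : Curve → M) (α : ℕ → Curve) (g i : ℕ) : M :=
  ((List.range (g - i + 1)).map fun j => tw (α (2*(i+j) - 1)) * (tw (α (2*(i+j))))⁻¹).prod

/-- The product `t_{α_{2i}}⁻¹ t_{α_{2i+1}} t_{α_{2i+2}}⁻¹ ⋯ t_{α_{2g-1}} t_{α_{2g}}⁻¹`. -/
def evenTail (tw : Curve → M) (α : ℕ → Curve) (g i : ℕ) : M :=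
  (tw (α (2*i)))⁻¹ *
    ((List.range (g - i)).map fun j => tw (α (2*(i+j) + 1)) * (tw (α (2*(i+j) + 2)))⁻¹).prod

/-- The `i`-th letter `(s i)^{±1}` of the alternating word, positive exactly when `i` is odd. -/
def altLetter {G : Type*} [Group G] (s : ℕ → G) (i : ℕ) : G :=
  if Even i then (s i)⁻¹ else s i

/-- The alternating word `(s k)^{±1} (s (k+1))^{±1} ⋯ (s (k+n-1))^{±1}`. -/
def altWord {G : Type*} [Group G] (s : ℕ → G) (k n : ℕ) : G :=
  ((List.range' k n).map (altLetter s)).prod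

section AltWord

variable {G : Type*} [Group G] (s : ℕ → G)

theorem altWord_succ (k n : ℕ) : altWord s k (n + 1) = altLetter s k * altWord s (k + 1) n := by
  simp [altWord, List.range'_succ]

theorem altWord_concat (k n : ℕ) : altWord s k (n + 1) = altWord s k n * altLetter s (k + n) := by
  simp [altWord, List.range'_concat]

variable {s}

theorem altLetter_mem {K : Subgroup G} {i : ℕ} (h : s i ∈ K) : altLetter s i ∈ K := by
  unfold altLetter
  split_ifs
  · exact K.inv_mem h
  · exact h

theorem altWord_mem {K : Subgroup G} {k n : ℕ} (h : ∀ i, k ≤ i → i < k + n → s i ∈ K) :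
    altWord s k n ∈ K := by
  refine K.list_prod_mem fun x hx => ?_
  obtain ⟨i, hi, rfl⟩ := List.mem_map.1 hx
  rw [List.mem_range'_1] at hi
  exact altLetter_mem (h i hi.1 hi.2)

theorem commute_altWord {x : G} {k n : ℕ} (h : ∀ i, k ≤ i → i < k + n → Commute x (s i)) :
    Commute x (altWord s k n) := by
  refine Commute.list_prod_right _ _ fun y hy => ?_
  obtain ⟨i, hi, rfl⟩ := List.mem_map.1 hy
  rw [List.mem_range'_1] at hi
  have hc := h i hi.1 hi.2
  unfold altLetter
  split_ifs
  · exact hc.inv_right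
  · exact hc

/-- If `a` and `b` satisfy the braid relation, `e` is `b` or `b⁻¹` and `w` commutes with `a`, then
a subgroup containing `a` and `e * w` contains `b`. -/
theorem mem_of_braid {K : Subgroup G} {a b e w : G} (hab : a * b * a = b * a * b)
    (he : e = b⁻¹ ∨ e = b) (hw : Commute a w) (ha : a ∈ K) (hew : e * w ∈ K) : b ∈ K := by
  have hconj : e * a * e⁻¹ ∈ K := by
    have h := K.mul_mem (K.mul_mem hew ha) (K.inv_mem hew)
    have h' : e * w * a * (e * w)⁻¹ = e * a * e⁻¹ := by
      rw [mul_assoc e w a, ← hw.eq]; group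
    rwa [h'] at h
  rcases he with rfl | rfl
  · have h : b = a⁻¹ * (b⁻¹ * a * b⁻¹⁻¹) * a := by
      calc b = a⁻¹ * b⁻¹ * (b * a * b) := by group
        _ = a⁻¹ * b⁻¹ * (a * b * a) := by rw [hab]
        _ = a⁻¹ * (b⁻¹ * a * b⁻¹⁻¹) * a := by group
    rw [h]
    exact K.mul_mem (K.mul_mem (K.inv_mem ha) hconj) ha
  · have h : e = a * (e * a * e⁻¹) * a⁻¹ := by
      calc e = (e * a * e) * e⁻¹ * a⁻¹ := by group
        _ = (a * e * a) * e⁻¹ * a⁻¹ := by rw [hab]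
        _ = a * (e * a * e⁻¹) * a⁻¹ := by group
    rw [h]
    exact K.mul_mem (K.mul_mem ha hconj) (K.inv_mem ha)

/-- In a group with braid generators `s k, …, s (k+n)`, a subgroup containing `s k` and the
alternating word in the remaining generators contains all of them. -/
theorem mem_of_altWord_mem {K : Subgroup G} (n k : ℕ)
    (h_braid : ∀ i, k ≤ i → i < k + n → s i * s (i + 1) * s i = s (i + 1) * s i * s (i + 1))
    (h_comm : ∀ i j, k ≤ i → i + 1 < j → j ≤ k + n → Commute (s i) (s j))
    (hk : s k ∈ K) (hw : altWord s (k + 1) n ∈ K) :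
    ∀ i, k ≤ i → i ≤ k + n → s i ∈ K := by
  induction n generalizing k with
  | zero =>
    intro i h₁ h₂
    obtain rfl : i = k := by omega
    exact hk
  | succ n ih =>
    rw [altWord_succ] at hw
    have hk' : s (k + 1) ∈ K := by
      refine mem_of_braid (h_braid k le_rfl (by omega)) ?_
        (commute_altWord fun i h₁ h₂ => h_comm k i le_rfl (by omega) (by omega)) hk hw
      unfold altLetter
      split_ifs <;> simp
    intro i h₁ h₂
    rcases h₁.eq_or_lt with rfl | h₁
    · exact hk
    · exact ih (k + 1) (fun i _ _ => h_braid i (by omega) (by omega))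
        (fun i j _ h _ => h_comm i j (by omega) h (by omega)) hk'
        ((K.mul_mem_cancel_left (altLetter_mem hk')).1 hw) i h₁ (by omega)

end AltWord

theorem oddTail_mul_eq_altWord (tw : Curve → M) (α : ℕ → Curve) {g : ℕ} (hg : 1 ≤ g) :
    oddTail tw α g 1 * tw (α (2*g+1)) = altWord (fun i => tw (α i)) 1 (2*g+1) := by
  have key : ∀ n, ((List.range n).map fun j =>
      tw (α (2*(1+j) - 1)) * (tw (α (2*(1+j))))⁻¹).prod =
        altWord (fun i => tw (α i)) 1 (2*n) := by
    intro n
    induction n with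
    | zero => simp [altWord]
    | succ n ih =>
      have h₁ : 2*(1+n) - 1 = 1 + 2*n := by omega
      have h₂ : 2*(1+n) = 1 + (2*n + 1) := by omega
      have h₃ : ¬ Even (1 + 2*n) := by grind
      have h₄ : Even (1 + (2*n + 1)) := by grind
      rw [List.range_succ, List.map_append, List.prod_append, ih, Nat.mul_succ, altWord_concat,
        altWord_concat, mul_assoc]
      simp only [List.map_cons, List.map_nil, List.prod_singleton, h₁, altLetter, if_neg h₃,
        if_pos h₄]
      rw [h₂]
  have h : ¬ Even (1 + 2*g) := by grind
  rw [oddTail, Nat.sub_add_cancel hg, key, altWord_concat, altLetter, if_neg h, add_comm 1]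

theorem evenTail_mul_eq_altWord (tw : Curve → M) (α : ℕ → Curve) {g : ℕ} (hg : 1 ≤ g) :
    evenTail tw α g 1 * tw (α (2*g+1)) = altWord (fun i => tw (α i)) 2 (2*g) := by
  have key : ∀ n, (tw (α 2))⁻¹ * ((List.range n).map fun j =>
      tw (α (2*(1+j) + 1)) * (tw (α (2*(1+j) + 2)))⁻¹).prod =
        altWord (fun i => tw (α i)) 2 (2*n + 1) := by
    intro n
    induction n with
    | zero => simp [altWord, altLetter]
    | succ n ih =>
      have h₁ : 2*(1+n) + 1 = 2 + (2*n + 1) := by omega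
      have h₂ : 2*(1+n) + 2 = 2 + (2*n + 1 + 1) := by omega
      have h₃ : ¬ Even (2 + (2*n + 1)) := by grind
      have h₄ : Even (2 + (2*n + 1 + 1)) := by grind
      rw [List.range_succ, List.map_append, List.prod_append, ← mul_assoc, ih,
        show 2*(n+1) + 1 = 2*n + 1 + 1 + 1 by ring, altWord_concat _ _ (2*n + 1 + 1),
        altWord_concat _ _ (2*n + 1), mul_assoc]
      simp only [List.map_cons, List.map_nil, List.prod_singleton, h₁, h₂, altLetter, if_neg h₃,
        if_pos h₄]
  obtain ⟨n, rfl⟩ : ∃ n, g = n + 1 := ⟨g - 1, by omega⟩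
  have h : ¬ Even (2 + (2*n + 1)) := by grind
  rw [evenTail, Nat.add_sub_cancel, mul_one, key, show 2*(n+1) = 2*n + 1 + 1 by ring,
    altWord_concat _ _ (2*n + 1), altLetter, if_neg h, add_comm 2]

/-- **Theorem (Hirose–Monden).**
For `g ≥ 1`, the subgroup of the hyperelliptic mapping class group `H_g` generated by
`h₁ = t_{α_1} t_{α_2}⁻¹ t_{α_3} t_{α_4}⁻¹ ⋯ t_{α_{2g-1}} t_{α_{2g}}⁻¹ t_{α_{2g+1}}` and
`h₂ = t_{α_2}⁻¹ t_{α_3} t_{α_4}⁻¹ ⋯ t_{α_{2g-1}} t_{α_{2g}}⁻¹ t_{α_{2g+1}}` is all of `H_g`.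

Setting: `M` is the mapping class group of `Σ_g`; `tw c` is the right-handed Dehn twist about
`c`; `α 1, …, α (2g+1), β` is the Humphries configuration (with its braid and commutation
relations); `H` is the hyperelliptic mapping class group, generated by
`t_{α_1}, …, t_{α_{2g+1}}`. -/
theorem hyperelliptic_generated_by_h1_h2
    (g : ℕ) (hg : 1 ≤ g)
    (M : Type) [Group M] (Curve : Type)
    (tw : Curve → M)
    (α : ℕ → Curve) (β : Curve)
    (h_braid : ∀ i, 1 ≤ i → i ≤ 2*g →
      tw (α i) * tw (α (i+1)) * tw (α i) = tw (α (i+1)) * tw (α i) * tw (α (i+1)))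
    (h_comm : ∀ i j, 1 ≤ i → i + 1 < j → j ≤ 2*g+1 → Commute (tw (α i)) (tw (α j)))
    (h_beta_comm : ∀ i, 1 ≤ i → i ≤ 2*g+1 → i ≠ 4 → Commute (tw β) (tw (α i)))
    (h_beta_braid : tw β * tw (α 4) * tw β = tw (α 4) * tw β * tw (α 4))
    (H : Subgroup M)                     -- the hyperelliptic mapping class group
    (hH : H = Subgroup.closure ((fun i => tw (α i)) '' Set.Icc 1 (2*g+1))) :
    Subgroup.closure ({oddTail tw α g 1 * tw (α (2*g+1)),
        evenTail tw α g 1 * tw (α (2*g+1))} : Set M) = H := by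
  rw [oddTail_mul_eq_altWord tw α hg, evenTail_mul_eq_altWord tw α hg, hH]
  have hmem : ∀ i, 1 ≤ i → i ≤ 2*g+1 →
      tw (α i) ∈ Subgroup.closure ((fun i => tw (α i)) '' Set.Icc 1 (2*g+1)) :=
    fun i h₁ h₂ => Subgroup.subset_closure ⟨i, ⟨h₁, h₂⟩, rfl⟩
  apply le_antisymm
  · rw [Subgroup.closure_le]
    rintro x (rfl | rfl)
    · exact altWord_mem fun i _ _ => hmem i (by omega) (by omega)
    · exact altWord_mem fun i _ _ => hmem i (by omega) (by omega)
  · rw [Subgroup.closure_le]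
    set K := Subgroup.closure ({altWord (fun i => tw (α i)) 1 (2*g+1),
      altWord (fun i => tw (α i)) 2 (2*g)} : Set M)
    have h₁ : altWord (fun i => tw (α i)) 1 (2*g+1) ∈ K := Subgroup.subset_closure (by simp)
    have h₂ : altWord (fun i => tw (α i)) 2 (2*g) ∈ K := Subgroup.subset_closure (by simp)
    rw [altWord_succ, K.mul_mem_cancel_right h₂, altLetter, if_neg Nat.not_even_one] at h₁
    rintro _ ⟨i, ⟨hi₁, hi₂⟩, rfl⟩
    exact mem_of_altWord_mem (s := fun i => tw (α i)) (2*g) 1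
      (fun i h h' => h_braid i h (by omega))
      (fun i j h h' h'' => h_comm i j h h' (by omega)) h₁ h₂ i hi₁ (by omega)

end HumphriesStmt8
end

section
/- For g ≥ 3, the subgroup G of the mapping class group M_g generated by f_1 = t_β t_{α_1} t_{α_2}^{-1} t_{α_3} t_{α_4}^{-1} ⋯ t_{α_{2g-1}} t_{α_{2g}}^{-1} and f_2 = t_β t_{α_2}^{-1} t_{α_3} t_{α_4}^{-1} ⋯ t_{α_{2g-1}} t_{α_{2g}}^{-1} is all of M_g. -/
namespace HumphriesStmt9

variable {M : Type} [Group M] {Curve : Type}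

/-- The product `t_{α_{2i-1}} t_{α_{2i}}⁻¹ t_{α_{2i+1}} t_{α_{2i+2}}⁻¹ ⋯ t_{α_{2g-1}} t_{α_{2g}}⁻¹`. -/
def oddTail (tw : Curve → M) (α : ℕ → Curve) (g i : ℕ) : M :=
  ((List.range (g - i + 1)).map fun j => tw (α (2*(i+j) - 1)) * (tw (α (2*(i+j))))⁻¹).prod

/-- The product `t_{α_{2i}}⁻¹ t_{α_{2i+1}} t_{α_{2i+2}}⁻¹ ⋯ t_{α_{2g-1}} t_{α_{2g}}⁻¹`. -/
def evenTail (tw : Curve → M) (α : ℕ → Curve) (g i : ℕ) : M :=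
  (tw (α (2*i)))⁻¹ *
    ((List.range (g - i)).map fun j => tw (α (2*(i+j) + 1)) * (tw (α (2*(i+j) + 2)))⁻¹).prod

section ArtinRelations

variable {G : Type*} [Group G]

theorem conj_eq_of_braid {x y : G} (h : x * y * x = y * x * y) : x * y * x⁻¹ = y⁻¹ * x * y := by
  rw [mul_inv_eq_iff_eq_mul, mul_assoc, mul_assoc, eq_inv_mul_iff_mul_eq, ← mul_assoc, ← mul_assoc,
    ← h]

theorem inv_conj_eq_of_braid {x y : G} (h : x * y * x = y * x * y) :
    x⁻¹ * y * x = y * x * y⁻¹ :=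
  (conj_eq_of_braid h.symm).symm

theorem mem_of_conj_mem_left {H : Subgroup G} {x y : G} (hx : x ∈ H) (h : x * y * x⁻¹ ∈ H) :
    y ∈ H := by
  have := H.mul_mem (H.mul_mem (H.inv_mem hx) h) hx
  simpa [mul_assoc] using this

theorem mem_of_braid_of_conj_mem {H : Subgroup G} {x y : G} (hb : x * y * x = y * x * y)
    (hy : y ∈ H) (h : x * y * x⁻¹ ∈ H) : x ∈ H := by
  rw [conj_eq_of_braid hb] at h
  have := H.mul_mem (H.mul_mem hy h) (H.inv_mem hy)
  simpa [mul_assoc] using this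

/-- If `b` and `r` commute and both braid with `c`, then `b * r` and `c` satisfy the Artin relation
of length four. -/
theorem artin_four_of_braid {b c r : G} (hbr : Commute b r) (hbc : b * c * b = c * b * c)
    (hcr : c * r * c = r * c * r) : b * r * c * (b * r) * c = c * (b * r) * c * (b * r) :=
  calc b * r * c * (b * r) * c = b * r * c * (r * b) * c := by rw [← hbr.eq]
    _ = b * (r * c * r) * b * c := by group
    _ = b * c * r * (c * b * c) := by rw [← hcr]; group
    _ = b * c * (r * b) * c * b := by rw [← hbc]; group
    _ = b * c * b * r * c * b := by rw [← hbr.eq]; group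
    _ = c * b * (c * r * c) * b := by rw [hbc]; group
    _ = c * b * r * c * (r * b) := by rw [hcr]; group
    _ = c * (b * r) * c * (b * r) := by rw [← hbr.eq]; group

/-- For a chain `b, c, r, s` and `z = X b r s⁻¹ R`, where `X` commutes with the chain and `R` with
`b, c, r`, the element `r s r⁻¹` is a word in `c` and `z`. -/
theorem conj_eq_word_of_chain {b c r s X R : G}
    (hbc : b * c * b = c * b * c) (hcr : c * r * c = r * c * r) (hrs : r * s * r = s * r * s)
    (hbr : Commute b r) (hbs : Commute b s) (hcs : Commute c s)
    (hXb : Commute X b) (hXc : Commute X c) (hXr : Commute X r) (hXs : Commute X s)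
    (hRb : Commute R b) (hRc : Commute R c) (hRr : Commute R r)
    {z : G} (hz : z = X * b * r * s⁻¹ * R) :
    r * s * r⁻¹ = c⁻¹ * (z * (c * z) * c * (z * (c * z))⁻¹) * c := by
  set t := r * s * r⁻¹ with ht
  have hXt : Commute X t := (hXr.mul_right hXs).mul_right hXr.inv_right
  have hbt : Commute b t := (hbr.mul_right hbs).mul_right hbr.inv_right
  have h₁ : SemiconjBy z c (b * r * c * (b * r)⁻¹) := by
    have hz' : z = X * (b * r * (s⁻¹ * R)) := by rw [hz]; group
    rw [hz']
    have hX : Commute X (b * r * c * (b * r)⁻¹) :=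
      ((hXb.mul_right hXr).mul_right hXc).mul_right (hXb.mul_right hXr).inv_right
    have hsR : Commute (s⁻¹ * R) c := hcs.symm.inv_left.mul_left hRc
    have hbr' : SemiconjBy (b * r) c (b * r * c * (b * r)⁻¹) := by rw [SemiconjBy]; group
    exact SemiconjBy.mul_left hX (hbr'.mul_left hsR)
  have h₂ : SemiconjBy c (b * r * c * (b * r)⁻¹) ((b * r)⁻¹ * c * (b * r)) := by
    have h := artin_four_of_braid hbr hbc hcr
    rw [SemiconjBy, ← mul_assoc, mul_inv_eq_iff_eq_mul, mul_assoc, mul_assoc, mul_assoc,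
      mul_assoc, eq_inv_mul_iff_mul_eq]
    simpa only [mul_assoc] using h
  have h₃ : SemiconjBy z ((b * r)⁻¹ * c * (b * r)) (t⁻¹ * c * t) := by
    have hz' : z = X * (t⁻¹ * (R * (b * r))) := by
      rw [(hRb.mul_right hRr).eq, hz, ← mul_assoc t⁻¹, ← mul_assoc t⁻¹, hbt.symm.inv_left.eq, ht]
      group
    rw [hz']
    have hbr' : SemiconjBy (b * r) ((b * r)⁻¹ * c * (b * r)) c := by simp [SemiconjBy, mul_assoc]
    have ht' : SemiconjBy t⁻¹ c (t⁻¹ * c * t) := by simp [SemiconjBy]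
    have hX : Commute X (t⁻¹ * c * t) := (hXt.inv_right.mul_right hXc).mul_right hXt
    exact SemiconjBy.mul_left hX (ht'.mul_left (SemiconjBy.mul_left hRc hbr'))
  have h₄ : t⁻¹ * c * t = c * t * c⁻¹ := by
    refine inv_conj_eq_of_braid ?_
    have hs : t = s⁻¹ * r * s := conj_eq_of_braid hrs
    have hc : c = s⁻¹ * c * s := by rw [mul_assoc, hcs.eq]; group
    calc t * c * t = (s⁻¹ * r * s) * (s⁻¹ * c * s) * (s⁻¹ * r * s) := by rw [← hs, ← hc]
      _ = s⁻¹ * (r * c * r) * s := by group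
      _ = s⁻¹ * (c * r * c) * s := by rw [hcr]
      _ = (s⁻¹ * c * s) * (s⁻¹ * r * s) * (s⁻¹ * c * s) := by group
      _ = c * t * c := by rw [← hs, ← hc]
  have h₅ : z * (c * z) * c = c * t * c⁻¹ * (z * (c * z)) := by
    rw [← h₄]
    exact (h₃.mul_left (h₂.mul_left h₁)).eq
  rw [h₅]
  group

/-- Descent along a chain `b, p 0, p 1, …, p (2 n)`: a subgroup containing `b (p 0) b⁻¹` and
`X b (p 1) (p 2)⁻¹ ⋯ (p (2 n - 1)) (p (2 n))⁻¹`, where `X` commutes with the chain, contains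
the whole chain. -/
theorem chain_mem_of_conj_mem {H : Subgroup G} (n : ℕ) : ∀ (p : ℕ → G) (b X : G),
    (∀ i, i + 1 ≤ 2 * n → p i * p (i + 1) * p i = p (i + 1) * p i * p (i + 1)) →
    (∀ i j, i + 1 < j → j ≤ 2 * n → Commute (p i) (p j)) →
    b * p 0 * b = p 0 * b * p 0 →
    (∀ i, 1 ≤ i → i ≤ 2 * n → Commute b (p i)) →
    Commute X b → (∀ i, i ≤ 2 * n → Commute X (p i)) →
    b * p 0 * b⁻¹ ∈ H →
    X * b * ((List.range n).map fun j => p (2 * j + 1) * (p (2 * j + 2))⁻¹).prod ∈ H →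
    b ∈ H ∧ ∀ i, i ≤ 2 * n → p i ∈ H := by
  have start_mem : ∀ {b c X : G}, b * c * b = c * b * c → Commute X b → Commute X c →
      b * c * b⁻¹ ∈ H → X * b ∈ H → b ∈ H ∧ c ∈ H := by
    intro b c X hbc hXb hXc hd hz
    have hc : c ∈ H := by
      have h := H.mul_mem (H.mul_mem (H.inv_mem hz) hd) hz
      have e : (X * b)⁻¹ * (b * c * b⁻¹) * (X * b) = c := by
        calc (X * b)⁻¹ * (b * c * b⁻¹) * (X * b)
            = X⁻¹ * (c * X) := by rw [hXb.eq]; group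
          _ = c := by rw [← hXc.eq]; group
      rwa [e] at h
    exact ⟨mem_of_braid_of_conj_mem hbc hc hd, hc⟩
  induction n with
  | zero =>
    intro p b X _ _ hbc _ hXb hXp hd hz
    have h := start_mem hbc hXb (hXp 0 le_rfl) hd (by simpa using hz)
    refine ⟨h.1, fun i hi => ?_⟩
    obtain rfl : i = 0 := by omega
    exact h.2
  | succ n ih =>
    intro p b X hp hcomm hbc hb hXb hXp hd hz
    set R := ((List.range n).map fun j => p (2 * j + 1 + 2) * (p (2 * j + 2 + 2))⁻¹).prod with hR
    have hzR : X * b * ((List.range (n + 1)).map fun j =>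
        p (2 * j + 1) * (p (2 * j + 2))⁻¹).prod = X * b * p 1 * (p 2)⁻¹ * R := by
      simp only [List.range_succ_eq_map, List.map_cons, List.prod_cons, List.map_map, hR,
        mul_assoc]
      rfl
    rw [hzR] at hz
    have hRcomm : ∀ x, (∀ i, 3 ≤ i → i ≤ 2 * (n + 1) → Commute x (p i)) → Commute R x := by
      intro x hx
      refine (Commute.list_prod_right _ _ fun y hy => ?_).symm
      obtain ⟨j, hj, rfl⟩ := List.mem_map.1 hy
      have hj := List.mem_range.1 hj
      exact (hx _ (by omega) (by omega)).mul_right (hx _ (by omega) (by omega)).inv_right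
    have hb1 : Commute b (p 1) := hb 1 (by omega) (by omega)
    have hb2 : Commute b (p 2) := hb 2 (by omega) (by omega)
    have hX0 : Commute X (p 0) := hXp 0 (by omega)
    have hX1 : Commute X (p 1) := hXp 1 (by omega)
    have hX2 : Commute X (p 2) := hXp 2 (by omega)
    have hRb : Commute R b := hRcomm b fun i h₁ h₂ => hb i (by omega) h₂
    have hR0 : Commute R (p 0) := hRcomm _ fun i h₁ h₂ => hcomm 0 i (by omega) h₂
    have hR1 : Commute R (p 1) := hRcomm _ fun i h₁ h₂ => hcomm 1 i (by omega) h₂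
    have ht : p 1 * p 2 * (p 1)⁻¹ ∈ H := by
      set z := X * b * p 1 * (p 2)⁻¹ * R with hzdef
      have hbz : Commute b z := ((((hXb.symm.mul_right (.refl b)).mul_right hb1).mul_right
        hb2.inv_right).mul_right hRb.symm)
      have hbt : Commute b (p 1 * p 2 * (p 1)⁻¹) :=
        (hb1.mul_right hb2).mul_right hb1.inv_right
      have h := conj_eq_word_of_chain hbc (hp 0 (by omega)) (hp 1 (by omega)) hb1 hb2
        (hcomm 0 2 (by omega) (by omega)) hXb hX0 hX1 hX2 hRb hR0 hR1 hzdef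
      have hz' : b * z * b⁻¹ = z := by rw [hbz.eq]; group
      have h' : p 1 * p 2 * (p 1)⁻¹ = (b * p 0 * b⁻¹)⁻¹ *
          (z * (b * p 0 * b⁻¹ * z) * (b * p 0 * b⁻¹) * (z * (b * p 0 * b⁻¹ * z))⁻¹) *
          (b * p 0 * b⁻¹) :=
        calc p 1 * p 2 * (p 1)⁻¹ = b * (p 1 * p 2 * (p 1)⁻¹) * b⁻¹ := by rw [hbt.eq]; group
          _ = (b * p 0 * b⁻¹)⁻¹ * ((b * z * b⁻¹) * (b * p 0 * b⁻¹ * (b * z * b⁻¹)) *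
              (b * p 0 * b⁻¹) * ((b * z * b⁻¹) * (b * p 0 * b⁻¹ * (b * z * b⁻¹)))⁻¹) *
              (b * p 0 * b⁻¹) := by rw [h]; group
          _ = _ := by rw [hz']
      rw [h']
      have hw := H.mul_mem hz (H.mul_mem hd hz)
      exact H.mul_mem (H.mul_mem (H.inv_mem hd) (H.mul_mem (H.mul_mem hw hd) (H.inv_mem hw))) hd
    have hz₁ : X * b * p 1 * R ∈ H := by
      have e : p 1 * p 2 * (p 1)⁻¹ * (X * b * p 1 * (p 2)⁻¹ * R) = X * b * p 1 * R := by
        have hc : Commute (p 1 * p 2 * (p 1)⁻¹) (X * b) :=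
          (((hX1.mul_right hX2).mul_right hX1.inv_right).mul_left
            ((hb1.mul_right hb2).mul_right hb1.inv_right)).symm
        calc p 1 * p 2 * (p 1)⁻¹ * (X * b * p 1 * (p 2)⁻¹ * R)
            = p 1 * p 2 * (p 1)⁻¹ * (X * b) * (p 1 * (p 2)⁻¹ * R) := by group
          _ = X * b * p 1 * R := by rw [hc.eq]; group
      rw [← e]
      exact H.mul_mem ht hz
    obtain ⟨h1, hrest⟩ := ih (fun i => p (i + 2)) (p 1) (X * b)
      (fun i hi => hp (i + 2) (by omega)) (fun i j hij hj => hcomm _ _ (by omega) (by omega))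
      (hp 1 (by omega)) (fun i h₁ h₂ => hcomm _ _ (by omega) (by omega))
      (hX1.mul_left hb1) (fun i hi => (hXp _ (by omega)).mul_left (hb _ (by omega) (by omega)))
      ht hz₁
    have hRH : R ∈ H := by
      refine H.list_prod_mem fun y hy => ?_
      obtain ⟨j, hj, rfl⟩ := List.mem_map.1 hy
      have hj := List.mem_range.1 hj
      exact H.mul_mem (hrest (2 * j + 1) (by omega)) (H.inv_mem (hrest (2 * j + 2) (by omega)))
    have hXbH : X * b ∈ H :=
      (H.mul_mem_cancel_right h1).1 ((H.mul_mem_cancel_right hRH).1 hz₁)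
    have h := start_mem hbc hXb hX0 hd hXbH
    refine ⟨h.1, fun i hi => ?_⟩
    match i with
    | 0 => exact h.2
    | 1 => exact h1
    | i + 2 => exact hrest i (by omega)

/-- If a subgroup contains `a 1` and `b (a 2)⁻¹ (a 3) (a 4)⁻¹ ⋯ (a (2 n + 3)) (a (2 n + 4))⁻¹`, where
the `a i` form a chain and `b` is attached to `a 4`, then it contains `b` and the chain. -/
theorem generators_mem_of_mem {H : Subgroup G} {n : ℕ} {a : ℕ → G} {b : G}
    (hbraid : ∀ i, 1 ≤ i → i + 1 ≤ 2 * (n + 2) →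
      a i * a (i + 1) * a i = a (i + 1) * a i * a (i + 1))
    (hcomm : ∀ i j, 1 ≤ i → i + 1 < j → j ≤ 2 * (n + 2) → Commute (a i) (a j))
    (hb : ∀ i, 1 ≤ i → i ≤ 2 * (n + 2) → i ≠ 4 → Commute b (a i))
    (hb4 : b * a 4 * b = a 4 * b * a 4) (h1 : a 1 ∈ H)
    (hf : b * ((a 2)⁻¹ * (a 3 * (a 4)⁻¹ *
      ((List.range n).map fun j => a (4 + (2 * j + 1)) * (a (4 + (2 * j + 2)))⁻¹).prod)) ∈ H) :
    b ∈ H ∧ ∀ i, 1 ≤ i → i ≤ 2 * (n + 2) → a i ∈ H := by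
  set T := ((List.range n).map fun j => a (4 + (2 * j + 1)) * (a (4 + (2 * j + 2)))⁻¹).prod with hT
  have hTcomm : ∀ i, 1 ≤ i → i ≤ 3 → Commute T (a i) := by
    intro i hi hi'
    refine (Commute.list_prod_right _ _ fun y hy => ?_).symm
    obtain ⟨j, hj, rfl⟩ := List.mem_map.1 hy
    have hj := List.mem_range.1 hj
    exact (hcomm _ _ hi (by omega) (by omega)).mul_right
      (hcomm _ _ hi (by omega) (by omega)).inv_right
  have hconj : ∀ {x y : G}, x ∈ H → y ∈ H → x * y * x⁻¹ ∈ H := fun hx hy =>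
    H.mul_mem (H.mul_mem hx hy) (H.inv_mem hx)
  have hb1 : Commute b (a 1) := hb 1 (by omega) (by omega) (by omega)
  have hb2 : Commute b (a 2) := hb 2 (by omega) (by omega) (by omega)
  have hb3 : Commute b (a 3) := hb 3 (by omega) (by omega) (by omega)
  have h12 := hbraid 1 (by omega) (by omega)
  have h23 := hbraid 2 (by omega) (by omega)
  have h34 := hbraid 3 (by omega) (by omega)
  have h13 : Commute (a 1) (a 3) := hcomm 1 3 (by omega) (by omega) (by omega)
  have h14 : Commute (a 1) (a 4) := hcomm 1 4 (by omega) (by omega) (by omega)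
  have h24 : Commute (a 2) (a 4) := hcomm 2 4 (by omega) (by omega) (by omega)
  set f := b * ((a 2)⁻¹ * (a 3 * (a 4)⁻¹ * T)) with hfdef
  have h2 : a 2 ∈ H := by
    have e : SemiconjBy f (a 1) ((a 2)⁻¹ * a 1 * a 2) := by
      have e₁ : Commute (a 3 * (a 4)⁻¹ * T) (a 1) :=
        (h13.symm.mul_left h14.symm.inv_left).mul_left (hTcomm 1 (by omega) (by omega))
      have e₂ : SemiconjBy (a 2)⁻¹ (a 1) ((a 2)⁻¹ * a 1 * a 2) := by simp [SemiconjBy]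
      have e₃ : Commute b ((a 2)⁻¹ * a 1 * a 2) := (hb2.inv_right.mul_right hb1).mul_right hb2
      exact SemiconjBy.mul_left e₃ (e₂.mul_left e₁)
    have h := hconj hf h1
    rw [e.eq, mul_inv_cancel_right, ← conj_eq_of_braid h12] at h
    exact mem_of_conj_mem_left h1 h
  have h3 : a 3 ∈ H := by
    have e : SemiconjBy f (a 2) ((a 2)⁻¹ * ((a 2)⁻¹ * a 3 * a 2) * a 2) := by
      have e₁ : Commute ((a 4)⁻¹ * T) (a 2) :=
        h24.symm.inv_left.mul_left (hTcomm 2 (by omega) (by omega))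
      have e₂ : SemiconjBy (a 3) (a 2) ((a 2)⁻¹ * a 3 * a 2) := by
        rw [← conj_eq_of_braid h23.symm]
        simp [SemiconjBy]
      have e₃ : SemiconjBy (a 2)⁻¹ ((a 2)⁻¹ * a 3 * a 2)
          ((a 2)⁻¹ * ((a 2)⁻¹ * a 3 * a 2) * a 2) := by simp [SemiconjBy]
      have e₄ : Commute b ((a 2)⁻¹ * ((a 2)⁻¹ * a 3 * a 2) * a 2) :=
        (hb2.inv_right.mul_right ((hb2.inv_right.mul_right hb3).mul_right hb2)).mul_right hb2
      rw [hfdef, mul_assoc (a 3)]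
      exact SemiconjBy.mul_left e₄ (e₃.mul_left (e₂.mul_left e₁))
    have h := hconj h2 (hconj h2 (hconj hf h2))
    rw [e.eq] at h
    convert h using 1
    group
  have hy : b * (a 4)⁻¹ * T ∈ H := by
    have h := H.mul_mem (H.mul_mem (H.inv_mem h3) h2) hf
    have e : (a 3)⁻¹ * a 2 * f = b * (a 4)⁻¹ * T := by
      have hc : Commute ((a 3)⁻¹ * a 2) b := (hb3.symm.inv_left.mul_left hb2.symm)
      rw [hfdef, ← mul_assoc, hc.eq]
      group
    rwa [e] at h
  have hd : b * a 4 * b⁻¹ ∈ H := by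
    have e : SemiconjBy (b * (a 4)⁻¹ * T) (a 3) (a 3 * (b * a 4 * b⁻¹) * (a 3)⁻¹) := by
      have e₁ : SemiconjBy (a 4)⁻¹ (a 3) (a 3 * a 4 * (a 3)⁻¹) := by
        rw [conj_eq_of_braid h34]
        simp [SemiconjBy]
      have e₂ : SemiconjBy b (a 3 * a 4 * (a 3)⁻¹) (a 3 * (b * a 4 * b⁻¹) * (a 3)⁻¹) := by
        have e₃ : SemiconjBy b (a 4) (b * a 4 * b⁻¹) := by simp [SemiconjBy]
        exact (SemiconjBy.mul_right hb3 e₃).mul_right hb3.inv_right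
      exact (e₂.mul_left e₁).mul_left (hTcomm 3 (by omega) (by omega))
    have h := hconj hy h3
    rw [e.eq, mul_inv_cancel_right] at h
    exact mem_of_conj_mem_left h3 h
  have hz : 1 * b * T ∈ H := by
    have h := H.mul_mem hd hy
    have e : b * a 4 * b⁻¹ * (b * (a 4)⁻¹ * T) = 1 * b * T := by group
    rwa [e] at h
  obtain ⟨hbH, hrest⟩ := chain_mem_of_conj_mem n (fun i => a (4 + i)) b 1
    (fun i hi => hbraid (4 + i) (by omega) (by omega))
    (fun i j hij hj => hcomm _ _ (by omega) (by omega) (by omega)) hb4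
    (fun i h₁ h₂ => hb _ (by omega) (by omega) (by omega))
    (Commute.one_left _) (fun i _ => Commute.one_left _) hd hz
  refine ⟨hbH, fun i hi hi' => ?_⟩
  match i with
  | 1 => exact h1
  | 2 => exact h2
  | 3 => exact h3
  | i + 4 =>
    rw [add_comm]
    exact hrest i (by omega)

end ArtinRelations

theorem oddTail_one_eq (tw : Curve → M) (α : ℕ → Curve) {g : ℕ} (hg : 1 ≤ g) :
    oddTail tw α g 1 = tw (α 1) * evenTail tw α g 1 := by
  obtain ⟨n, rfl⟩ : ∃ n, g = n + 1 := ⟨g - 1, by omega⟩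
  have e : ∀ j, 2 * (1 + (j + 1)) - 1 = 2 * (1 + j) + 1 := fun j => by omega
  simp [oddTail, evenTail, List.range_succ_eq_map (n := n), Function.comp_def, e, mul_assoc]
  rfl

theorem evenTail_one_eq (tw : Curve → M) (α : ℕ → Curve) (n : ℕ) :
    evenTail tw α (n + 2) 1 = (tw (α 2))⁻¹ * (tw (α 3) * (tw (α 4))⁻¹ *
      ((List.range n).map fun j =>
        tw (α (4 + (2 * j + 1))) * (tw (α (4 + (2 * j + 2))))⁻¹).prod) := by
  have e₁ : ∀ j, 2 * (1 + (j + 1)) + 1 = 4 + (2 * j + 1) := fun j => by omega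
  have e₂ : ∀ j, 2 * (1 + (j + 1)) + 2 = 4 + (2 * j + 2) := fun j => by omega
  simp only [evenTail, show n + 2 - 1 = n + 1 from rfl, List.range_succ_eq_map, List.map_cons,
    List.prod_cons, List.map_map, Function.comp_def, Nat.succ_eq_add_one, e₁, e₂]

/-- **Theorem (Hirose–Monden).**
For `g ≥ 3`, the subgroup of the mapping class group `M_g` generated by
`f₁ = t_β t_{α_1} t_{α_2}⁻¹ t_{α_3} t_{α_4}⁻¹ ⋯ t_{α_{2g-1}} t_{α_{2g}}⁻¹` and
`f₂ = t_β t_{α_2}⁻¹ t_{α_3} t_{α_4}⁻¹ ⋯ t_{α_{2g-1}} t_{α_{2g}}⁻¹` is all of `M_g`.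

Setting: `M` is the mapping class group of `Σ_g`; `tw c` is the right-handed Dehn twist about
`c`; `α 1, …, α (2g+1), β` is the Humphries configuration (with its braid and commutation
relations), and `M_g` is generated by `t_{α_1}, …, t_{α_{2g}}, t_β` (Humphries). -/
theorem mcg_generated_by_f1_f2
    (g : ℕ) (hg : 3 ≤ g)
    (M : Type) [Group M] (Curve : Type)
    (tw : Curve → M)
    (α : ℕ → Curve) (β : Curve)
    (h_braid : ∀ i, 1 ≤ i → i ≤ 2*g →
      tw (α i) * tw (α (i+1)) * tw (α i) = tw (α (i+1)) * tw (α i) * tw (α (i+1)))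
    (h_comm : ∀ i j, 1 ≤ i → i + 1 < j → j ≤ 2*g+1 → Commute (tw (α i)) (tw (α j)))
    (h_beta_comm : ∀ i, 1 ≤ i → i ≤ 2*g+1 → i ≠ 4 → Commute (tw β) (tw (α i)))
    (h_beta_braid : tw β * tw (α 4) * tw β = tw (α 4) * tw β * tw (α 4))
    (hHumphries : Subgroup.closure
      (insert (tw β) ((fun i => tw (α i)) '' Set.Icc 1 (2*g))) = ⊤) :
    Subgroup.closure ({tw β * oddTail tw α g 1, tw β * evenTail tw α g 1} : Set M) = ⊤ := by
  set H := Subgroup.closure ({tw β * oddTail tw α g 1, tw β * evenTail tw α g 1} : Set M)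
  have hf₁ : tw β * oddTail tw α g 1 ∈ H := Subgroup.subset_closure (Set.mem_insert _ _)
  have hf₂ : tw β * evenTail tw α g 1 ∈ H :=
    Subgroup.subset_closure (Set.mem_insert_of_mem _ rfl)
  have h1 : tw (α 1) ∈ H := by
    have h := H.mul_mem hf₁ (H.inv_mem hf₂)
    have e : tw β * oddTail tw α g 1 * (tw β * evenTail tw α g 1)⁻¹ = tw (α 1) := by
      rw [oddTail_one_eq tw α (by omega), ← mul_assoc,
        (h_beta_comm 1 (by omega) (by omega) (by omega)).eq]
      group
    rwa [e] at h
  clear_value H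
  obtain ⟨n, rfl⟩ : ∃ n, g = n + 2 := ⟨g - 2, by omega⟩
  rw [evenTail_one_eq] at hf₂
  obtain ⟨hβ, hα⟩ := generators_mem_of_mem (a := fun i => tw (α i))
    (fun i h₁ h₂ => h_braid i h₁ (by omega)) (fun i j h₁ h₂ h₃ => h_comm i j h₁ h₂ (by omega))
    (fun i h₁ h₂ => h_beta_comm i h₁ (by omega)) h_beta_braid h1 hf₂
  rw [eq_top_iff, ← hHumphries, Subgroup.closure_le]
  rintro _ (rfl | ⟨i, hi, rfl⟩)
  · exact hβ
  · exact hα i hi.1 hi.2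

end HumphriesStmt9
end

section
/- Let g ≥ 3 and let G be the subgroup of M_g generated by f_1 and f_2. Then the elements t_{α_1}, t_{α_2}, t_{α_3}, t_{γ_4}, t_{γ_5}, f_3, f_4, and f_5 all belong to G, where γ_i denotes the simple closed curve t_{α_i}(α_{i+1}). -/
namespace HumphriesStmt10

variable {M : Type} [Group M] {Curve : Type}

/-- The product `t_{α_{2i-1}} t_{α_{2i}}⁻¹ t_{α_{2i+1}} t_{α_{2i+2}}⁻¹ ⋯ t_{α_{2g-1}} t_{α_{2g}}⁻¹`. -/
def oddTail (tw : Curve → M) (α : ℕ → Curve) (g i : ℕ) : M :=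
  ((List.range (g - i + 1)).map fun j => tw (α (2*(i+j) - 1)) * (tw (α (2*(i+j))))⁻¹).prod

/-- The product `t_{α_{2i}}⁻¹ t_{α_{2i+1}} t_{α_{2i+2}}⁻¹ ⋯ t_{α_{2g-1}} t_{α_{2g}}⁻¹`. -/
def evenTail (tw : Curve → M) (α : ℕ → Curve) (g i : ℕ) : M :=
  (tw (α (2*i)))⁻¹ *
    ((List.range (g - i)).map fun j => tw (α (2*(i+j) + 1)) * (tw (α (2*(i+j) + 2)))⁻¹).prod

/-- `f_{2i-1} = t_β t_{α_{2i-1}} t_{α_{2i}}⁻¹ ⋯ t_{α_{2g-1}} t_{α_{2g}}⁻¹`. -/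
def fOdd (tw : Curve → M) (α : ℕ → Curve) (β : Curve) (g i : ℕ) : M :=
  tw β * oddTail tw α g i

/-- `f_{2i} = t_β t_{α_{2i}}⁻¹ t_{α_{2i+1}} ⋯ t_{α_{2g-1}} t_{α_{2g}}⁻¹`. -/
def fEven (tw : Curve → M) (α : ℕ → Curve) (β : Curve) (g i : ℕ) : M :=
  tw β * evenTail tw α g i

theorem oddTail_eq_mul_evenTail (tw : Curve → M) (α : ℕ → Curve) (g i : ℕ) :
    oddTail tw α g i = tw (α (2*i - 1)) * evenTail tw α g i := by
  have h : ∀ j, 2 * (i + (j + 1)) = 2 * (i + j) + 2 := fun j => by omega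
  simp [oddTail, evenTail, List.range_succ_eq_map, Function.comp_def, h, mul_assoc]

theorem evenTail_eq_mul_oddTail (tw : Curve → M) (α : ℕ → Curve) {g i : ℕ} (hi : i < g) :
    evenTail tw α g i = (tw (α (2*i)))⁻¹ * oddTail tw α g (i + 1) := by
  have h : ∀ j, 2 * (i + 1 + j) = 2 * (i + j) + 2 := fun j => by omega
  have hg : g - (i + 1) + 1 = g - i := by omega
  simp only [oddTail, evenTail, h, hg, Nat.add_one_sub_one]

/-- `evenTail` is its leading letter times a word in the later twists. -/
theorem exists_evenTail_eq (tw : Curve → M) (α : ℕ → Curve) (g i : ℕ) :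
    ∃ w, evenTail tw α g i = (tw (α (2*i)))⁻¹ * w ∧
      ∀ m, (∀ k, 2*i < k → k ≤ 2*g → Commute m (tw (α k))) → Commute m w := by
  refine ⟨_, rfl, fun m hm => Commute.list_prod_right _ _ fun x hx => ?_⟩
  obtain ⟨j, hj, rfl⟩ := List.mem_map.1 hx
  rw [List.mem_range] at hj
  exact (hm _ (by omega) (by omega)).mul_right (hm _ (by omega) (by omega)).inv_right

theorem conj_mul_of_commute {v x : M} (p : M) (h : Commute v x) :
    p * v * x * (p * v)⁻¹ = p * x * p⁻¹ := by
  rw [mul_assoc p, h.eq]; group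

theorem inv_mul_mul_of_braid {x y : M} (h : x * y * x = y * x * y) :
    x⁻¹ * y * x = y * x * y⁻¹ := by
  rw [eq_mul_inv_iff_mul_eq, mul_assoc, mul_assoc, inv_mul_eq_iff_eq_mul, ← mul_assoc, ← mul_assoc,
    h]

/-- The step from the twist `x` to the next twist `y` of a chain. -/
theorem mem_of_conj_inv_mem {G : Subgroup M} {x y v : M} (hx : x ∈ G) (hf : y⁻¹ * v ∈ G)
    (hv : Commute v x) (h : x * y * x = y * x * y) : y ∈ G := by
  have key : y = x⁻¹ * (y⁻¹ * v * x * (y⁻¹ * v)⁻¹) * x := by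
    rw [conj_mul_of_commute _ hv, inv_inv, inv_mul_mul_of_braid h.symm]; group
  rw [key]
  exact G.mul_mem (G.mul_mem (G.inv_mem hx) (G.mul_mem (G.mul_mem hf hx) (G.inv_mem hf))) hx

/-- As `mem_of_conj_inv_mem`, with the opposite sign. -/
theorem mem_of_conj_mem {G : Subgroup M} {x y v : M} (hx : x ∈ G) (hf : y * v ∈ G)
    (hv : Commute v x) (h : x * y * x = y * x * y) : y ∈ G := by
  have key : y = x * (y * v * x * (y * v)⁻¹) * x⁻¹ := by
    rw [conj_mul_of_commute _ hv, ← inv_mul_mul_of_braid h]; group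
  rw [key]
  exact G.mul_mem (G.mul_mem hx (G.mul_mem (G.mul_mem hf hx) (G.inv_mem hf))) (G.inv_mem hx)

/-- If `b` and `y` both braid with `x` and commute, then `x y x⁻¹` lies in any subgroup containing
`b x b⁻¹` and `b y v` for some `v` commuting with `b` and `x`. -/
theorem conj_mem_of_commute_braid {G : Subgroup M} {b x y v : M} (hc : b * x * b⁻¹ ∈ G)
    (hf : b * y * v ∈ G) (hvx : Commute v x) (hvb : Commute v b) (hby : Commute b y)
    (hbx : b * x * b = x * b * x) (hxy : x * y * x = y * x * y) : x * y * x⁻¹ ∈ G := by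
  have key : x * y * x⁻¹ = b * x * b⁻¹ * (b * y * v * (b * x * b⁻¹) * (b * y * v)⁻¹) *
      (b * x * b⁻¹)⁻¹ := by
    have h1 : b * y * v * (b * x * b⁻¹) * (b * y * v)⁻¹ = b * b * (y * x * y⁻¹) * (b * b)⁻¹ := by
      have : b * y * v * (b * x * b⁻¹) * (b * y * v)⁻¹
          = b * y * (v * b) * x * (b * y * (v * b))⁻¹ := by group
      rw [this, hvb.eq, ← mul_assoc, conj_mul_of_commute _ hvx, mul_assoc b, ← hby.eq]; group
    have h2 : b * x * b⁻¹ * (b * b) = x * b * x := by rw [← hbx]; group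
    rw [h1, ← inv_mul_mul_of_braid hxy]
    have : b * x * b⁻¹ * (b * b * (x⁻¹ * y * x) * (b * b)⁻¹) * (b * x * b⁻¹)⁻¹
        = b * x * b⁻¹ * (b * b) * x⁻¹ * y * (b * x * b⁻¹ * (b * b) * x⁻¹)⁻¹ := by group
    rw [this, h2, mul_inv_cancel_right, conj_mul_of_commute _ hby]
  rw [key]
  exact G.mul_mem (G.mul_mem hc (G.mul_mem (G.mul_mem hf hc) (G.inv_mem hf))) (G.inv_mem hc)

/-- Moving the conjugate `x y x⁻¹` of a chain `x, y, z` one step further. -/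
theorem next_conj_mem {G : Subgroup M} {b x y z w : M} (hc : b * x * b⁻¹ ∈ G)
    (hf : b * y * (z⁻¹ * w) ∈ G) (hγ : x * y * x⁻¹ ∈ G) (hwx : Commute w x) (hwy : Commute w y)
    (hby : Commute b y) (hbz : Commute b z) (hxz : Commute x z)
    (hxy : x * y * x = y * x * y) (hyz : y * z * y = z * y * z) : y * z * y⁻¹ ∈ G := by
  have key : y * z * y⁻¹ = (b * x * b⁻¹)⁻¹ *
      (b * y * (z⁻¹ * w) * (x * y * x⁻¹) * (b * y * (z⁻¹ * w))⁻¹) * (b * x * b⁻¹) := by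
    have hw : Commute w (x * y * x⁻¹) := (hwx.mul_right hwy).mul_right hwx.inv_right
    have h1 : b * y * z⁻¹ * (x * y * x⁻¹) * (b * y * z⁻¹)⁻¹
        = b * x * (y * z * y⁻¹) * (b * x)⁻¹ := by
      have : b * y * z⁻¹ * (x * y * x⁻¹) * (b * y * z⁻¹)⁻¹
          = b * y * (z⁻¹ * x) * y * (b * y * (z⁻¹ * x))⁻¹ := by group
      rw [this, ← hxz.inv_right.eq]
      have : b * y * (x * z⁻¹) * y * (b * y * (x * z⁻¹))⁻¹
          = b * (y * x) * (z⁻¹ * y * z) * (b * (y * x))⁻¹ := by group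
      rw [this, inv_mul_mul_of_braid hyz.symm]
      have : b * (y * x) * (y * z * y⁻¹) * (b * (y * x))⁻¹
          = b * (y * x * y) * z * (b * (y * x * y))⁻¹ := by group
      rw [this, ← hxy]
      have : b * (x * y * x) * z * (b * (x * y * x))⁻¹
          = b * (x * y) * x * z * (b * (x * y) * x)⁻¹ := by group
      rw [this, conj_mul_of_commute _ hxz]; group
    rw [← mul_assoc (b * y), conj_mul_of_commute _ hw, h1]
    have : (b * x * b⁻¹)⁻¹ * (b * x * (y * z * y⁻¹) * (b * x)⁻¹) * (b * x * b⁻¹)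
        = b * (y * z * y⁻¹) * b⁻¹ := by group
    rw [this, ((hby.mul_right hbz).mul_right hby.inv_right).eq, mul_inv_cancel_right]
  rw [key]
  exact G.mul_mem (G.mul_mem (G.inv_mem hc) (G.mul_mem (G.mul_mem hf hγ) (G.inv_mem hf))) hc

/-- **Lemma 5 (Hirose–Monden).**
Let `g ≥ 3` and let `G` be the subgroup of `M_g` generated by `f₁` and `f₂`.  Then
`t_{α_1}, t_{α_2}, t_{α_3}, t_{γ_4}, t_{γ_5}, f₃, f₄, f₅` all belong to `G`, where
`γ_i = t_{α_i}(α_{i+1})`.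

Setting: `M` is the mapping class group of `Σ_g`, acting (via `act`) on isotopy classes of
simple closed curves; `tw c` is the right-handed Dehn twist about `c`, satisfying
`t_{f(c)} = f t_c f⁻¹`; `α 1, …, α (2g+1), β` is the Humphries configuration with its braid
and commutation relations; `f_{2i-1} = fOdd i` and `f_{2i} = fEven i`. -/
theorem twists_and_f3_f4_f5_in_G
    (g : ℕ) (hg : 3 ≤ g)
    (M : Type) [Group M] (Curve : Type)
    (act : M → Curve → Curve)
    (act_one : ∀ x : Curve, act 1 x = x)
    (act_mul : ∀ f h : M, ∀ x : Curve, act (f * h) x = act f (act h x))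
    (tw : Curve → M)
    (tw_conj : ∀ (f : M) (x : Curve), tw (act f x) = f * tw x * f⁻¹)
    (α : ℕ → Curve) (β : Curve)
    (h_braid : ∀ i, 1 ≤ i → i ≤ 2*g →
      tw (α i) * tw (α (i+1)) * tw (α i) = tw (α (i+1)) * tw (α i) * tw (α (i+1)))
    (h_comm : ∀ i j, 1 ≤ i → i + 1 < j → j ≤ 2*g+1 → Commute (tw (α i)) (tw (α j)))
    (h_beta_comm : ∀ i, 1 ≤ i → i ≤ 2*g+1 → i ≠ 4 → Commute (tw β) (tw (α i)))
    (h_beta_braid : tw β * tw (α 4) * tw β = tw (α 4) * tw β * tw (α 4))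
    (G : Subgroup M)
    (hG : G = Subgroup.closure ({fOdd tw α β g 1, fEven tw α β g 1} : Set M)) :
    tw (α 1) ∈ G ∧ tw (α 2) ∈ G ∧ tw (α 3) ∈ G ∧
    tw (act (tw (α 4)) (α 5)) ∈ G ∧
    tw (act (tw (α 5)) (α 6)) ∈ G ∧
    fOdd tw α β g 2 ∈ G ∧ fEven tw α β g 2 ∈ G ∧ fOdd tw α β g 3 ∈ G := by
  have hb (i : ℕ) (h1 : 1 ≤ i) (h2 : i ≤ 2*g) (h4 : i ≠ 4) : Commute (tw β) (tw (α i)) :=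
    h_beta_comm i h1 (by omega) h4
  have E1 := evenTail_eq_mul_oddTail tw α (show 1 < g by omega)
  have E2 := evenTail_eq_mul_oddTail tw α (show 2 < g by omega)
  have O1 := oddTail_eq_mul_evenTail tw α g 1
  have O2 := oddTail_eq_mul_evenTail tw α g 2
  have O3 := oddTail_eq_mul_evenTail tw α g 3
  obtain ⟨w1, hw1, cw1⟩ := exists_evenTail_eq tw α g 1
  obtain ⟨w2, hw2, cw2⟩ := exists_evenTail_eq tw α g 2
  obtain ⟨w3, hw3, cw3⟩ := exists_evenTail_eq tw α g 3
  norm_num at E1 E2 O1 O2 O3 hw1 hw2 hw3 cw1 cw2 cw3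
  have hf1 : fOdd tw α β g 1 ∈ G := hG ▸ Subgroup.subset_closure (by simp)
  have hf2 : fEven tw α β g 1 ∈ G := hG ▸ Subgroup.subset_closure (by simp)
  have b1 := hb 1 (by omega) (by omega) (by omega)
  have b2 := hb 2 (by omega) (by omega) (by omega)
  have b3 := hb 3 (by omega) (by omega) (by omega)
  have b5 := hb 5 (by omega) (by omega) (by omega)
  have b6 := hb 6 (by omega) (by omega) (by omega)
  have m1 : tw (α 1) ∈ G := by
    have : tw (α 1) = fOdd tw α β g 1 * (fEven tw α β g 1)⁻¹ := by
      rw [fOdd, fEven, O1, ← mul_assoc, b1.eq]; group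
    rw [this]
    exact G.mul_mem hf1 (G.inv_mem hf2)
  have e2 : fEven tw α β g 1 = (tw (α 2))⁻¹ * (tw β * w1) := by
    rw [fEven, hw1, ← mul_assoc, b2.inv_right.eq, mul_assoc]
  have m2 : tw (α 2) ∈ G := by
    refine mem_of_conj_inv_mem m1 (e2 ▸ hf2) (b1.mul_left (cw1 _ fun k h h' => ?_).symm)
      (h_braid 1 le_rfl (by omega))
    exact h_comm _ _ le_rfl (by omega) (by omega)
  have f3 : fOdd tw α β g 2 ∈ G := by
    have : fOdd tw α β g 2 = tw (α 2) * fEven tw α β g 1 := by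
      rw [fOdd, fEven, E1, ← mul_assoc (tw β), b2.inv_right.eq]; group
    rw [this]
    exact G.mul_mem m2 hf2
  have e3 : fOdd tw α β g 2 = tw (α 3) * fEven tw α β g 2 := by
    rw [fOdd, fEven, O2, ← mul_assoc, b3.eq, mul_assoc]
  have m3 : tw (α 3) ∈ G := by
    refine mem_of_conj_mem m2 (e3 ▸ f3) (b2.mul_left ?_) (h_braid 2 (by omega) (by omega))
    rw [hw2]
    refine ((h_comm 2 4 (by omega) (by omega) (by omega)).symm.inv_left).mul_left
      (cw2 _ fun k h h' => ?_).symm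
    exact h_comm _ _ (by omega) (by omega) (by omega)
  have f4 : fEven tw α β g 2 ∈ G := by
    rw [e3] at f3
    exact (G.mul_mem_cancel_left m3).1 f3
  have e4 : fEven tw α β g 2 = (tw β * tw (α 4) * (tw β)⁻¹)⁻¹ * (tw β * w2) := by
    rw [fEven, hw2]; group
  have m4 : tw β * tw (α 4) * (tw β)⁻¹ ∈ G := by
    refine mem_of_conj_inv_mem m3 (e4 ▸ f4) (b3.mul_left (cw2 _ fun k h h' => ?_).symm) ?_
    · exact h_comm _ _ (by omega) (by omega) (by omega)
    · have h := congrArg (fun t => tw β * t * (tw β)⁻¹) (h_braid 3 (by omega) (by omega))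
      have hc : tw (α 3) = tw β * tw (α 3) * (tw β)⁻¹ := by rw [b3.eq]; group
      simp only [Nat.reduceAdd] at h
      rw [hc]
      convert h using 1 <;> group
  have f5 : fOdd tw α β g 3 ∈ G := by
    have : fOdd tw α β g 3 = tw β * tw (α 4) * (tw β)⁻¹ * fEven tw α β g 2 := by
      rw [fOdd, fEven, E2]; group
    rw [this]
    exact G.mul_mem m4 f4
  have e5 : fOdd tw α β g 3 = tw β * tw (α 5) * ((tw (α 6))⁻¹ * w3) := by
    rw [fOdd, O3, hw3]; group
  rw [e5] at f5
  have c46 := h_comm 4 6 (by omega) (by omega) (by omega)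
  have w3b : Commute w3 (tw β) := (cw3 _ fun k h h' => hb _ (by omega) h' (by omega)).symm
  have w3x : Commute w3 (tw (α 4)) :=
    (cw3 _ fun k h h' => h_comm _ _ (by omega) (by omega) (by omega)).symm
  have w3y : Commute w3 (tw (α 5)) :=
    (cw3 _ fun k h h' => h_comm _ _ (by omega) (by omega) (by omega)).symm
  have br4 := h_braid 4 (by omega) (by omega)
  have br5 := h_braid 5 (by omega) (by omega)
  have γ4 := conj_mem_of_commute_braid m4 f5 (c46.symm.inv_left.mul_left w3x)
    (b6.symm.inv_left.mul_left w3b) b5 h_beta_braid br4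
  have γ5 := next_conj_mem m4 f5 γ4 w3x w3y b5 b6 c46 br4 br5
  rw [tw_conj, tw_conj, e5]
  exact ⟨m1, m2, m3, γ4, γ5, f3, f4, f5⟩

end HumphriesStmt10
end

section
/- Let g ≥ 4, let G be the subgroup of M_g generated by f_1 and f_2, and set F_{2k-1} = t_{α_3} t_{α_5} ⋯ t_{α_{2k-3}} f_{2k-1} for 3 ≤ k ≤ g. Suppose that for some i with 3 ≤ i ≤ g−1 the elements t_{γ_{2i-1}}, F_{2i-1}, and F_{2i+1} lie in G. Then: (1) t_{γ_{2i}} and t_{γ_{2i+1}} lie in G for 3 ≤ i ≤ g−1; (2) F_{2i+3} lies in G if i ≤ g−2; and (3) t_{α_{2g}} lies in G if i = g−1. -/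
namespace HumphriesStmt11

variable {M : Type} [Group M] {Curve : Type}

/-- The product `t_{α_{2i-1}} t_{α_{2i}}⁻¹ t_{α_{2i+1}} t_{α_{2i+2}}⁻¹ ⋯ t_{α_{2g-1}} t_{α_{2g}}⁻¹`. -/
def oddTail (tw : Curve → M) (α : ℕ → Curve) (g i : ℕ) : M :=
  ((List.range (g - i + 1)).map fun j => tw (α (2*(i+j) - 1)) * (tw (α (2*(i+j))))⁻¹).prod

/-- The product `t_{α_{2i}}⁻¹ t_{α_{2i+1}} t_{α_{2i+2}}⁻¹ ⋯ t_{α_{2g-1}} t_{α_{2g}}⁻¹`. -/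
def evenTail (tw : Curve → M) (α : ℕ → Curve) (g i : ℕ) : M :=
  (tw (α (2*i)))⁻¹ *
    ((List.range (g - i)).map fun j => tw (α (2*(i+j) + 1)) * (tw (α (2*(i+j) + 2)))⁻¹).prod

/-- `f_{2i-1} = t_β t_{α_{2i-1}} t_{α_{2i}}⁻¹ ⋯ t_{α_{2g-1}} t_{α_{2g}}⁻¹`. -/
def fOdd (tw : Curve → M) (α : ℕ → Curve) (β : Curve) (g i : ℕ) : M :=
  tw β * oddTail tw α g i

/-- `f_{2i} = t_β t_{α_{2i}}⁻¹ t_{α_{2i+1}} ⋯ t_{α_{2g-1}} t_{α_{2g}}⁻¹`. -/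
def fEven (tw : Curve → M) (α : ℕ → Curve) (β : Curve) (g i : ℕ) : M :=
  tw β * evenTail tw α g i

/-- `F_{2k-1} = t_{α_3} t_{α_5} ⋯ t_{α_{2k-3}} f_{2k-1}` (for `3 ≤ k ≤ g`). -/
def F (tw : Curve → M) (α : ℕ → Curve) (β : Curve) (g k : ℕ) : M :=
  ((List.range (k - 2)).map fun j => tw (α (2*j + 3))).prod * fOdd tw α β g k

section GroupIdentities

variable {x y z w P R : M}

theorem mul_mul_inv_eq_inv_mul_mul_of_braid (h : x * y * x = y * x * y) :
    x * y * x⁻¹ = y⁻¹ * x * y := by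
  rw [mul_inv_eq_iff_eq_mul, mul_assoc, mul_assoc, eq_inv_mul_iff_mul_eq, ← mul_assoc, ← mul_assoc,
    h]

/-- Half twists about the arcs `13` and `24` of a chain of three arcs are conjugate by
`(x y x⁻¹) x z`. -/
theorem semiconjBy_braid_chain_three (hxy : x * y * x = y * x * y) (hyz : y * z * y = z * y * z)
    (hxz : Commute x z) :
    SemiconjBy (x * y * x⁻¹ * (x * z)) (x * y * x⁻¹) (y * z * y⁻¹) := by
  have hxz' : x⁻¹ * z = z * x⁻¹ := hxz.inv_left.eq
  calc x * y * x⁻¹ * (x * z) * (x * y * x⁻¹)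
      = x * y * (z * x) * y * x⁻¹ := by group
    _ = (x * y * x) * z * y * x⁻¹ := by rw [← hxz.eq]; group
    _ = y * x * (y * z * y) * x⁻¹ := by rw [hxy]; group
    _ = y * (x * z) * y * (z * x⁻¹) := by rw [hyz]; group
    _ = y * z * (x * y * x⁻¹) * z := by rw [hxz.eq, ← hxz']; group
    _ = y * z * (y⁻¹ * x * y) * z := by rw [mul_mul_inv_eq_inv_mul_mul_of_braid hxy]
    _ = y * z * y⁻¹ * (x * y * x⁻¹ * (x * z)) := by group

/-- Half twists about the arcs `24` and `35` of a chain of four arcs are conjugate by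
`(x y x⁻¹)⁻¹ x z w⁻¹`. -/
theorem semiconjBy_braid_chain_four (hyz : y * z * y = z * y * z)
    (hzw : z * w * z = w * z * w) (hxz : Commute x z) (hxw : Commute x w) (hyw : Commute y w) :
    SemiconjBy ((x * y * x⁻¹)⁻¹ * (x * z * w⁻¹)) (y * z * y⁻¹) (z * w * z⁻¹) := by
  have hw : SemiconjBy w⁻¹ (y * z * y⁻¹) (y * (z * w * z⁻¹) * y⁻¹) := by
    have hy : SemiconjBy w⁻¹ y y := hyw.symm.inv_left
    have h : SemiconjBy w⁻¹ z (z * w * z⁻¹) := by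
      rw [mul_mul_inv_eq_inv_mul_mul_of_braid hzw]
      simp [SemiconjBy, mul_assoc]
    exact (hy.mul_right h).mul_right hy.inv_right
  have hz : SemiconjBy z (y * (z * w * z⁻¹) * y⁻¹) (y * (z * w * z⁻¹) * y⁻¹) := by
    have h : z * (y * z) = y * z * y := by rw [hyz, mul_assoc]
    calc z * (y * (z * w * z⁻¹) * y⁻¹)
        = z * (y * z) * w * (y * z)⁻¹ := by group
      _ = y * z * (y * w) * (y * z)⁻¹ := by rw [h]; group
      _ = y * z * w * (y * z)⁻¹ * (y * z * y) * (y * z)⁻¹ := by rw [hyw.eq]; group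
      _ = y * (z * w * z⁻¹) * y⁻¹ * z := by rw [← h]; group
  have hy : SemiconjBy y⁻¹ (y * (z * w * z⁻¹) * y⁻¹) (z * w * z⁻¹) := by
    simp [SemiconjBy, mul_assoc]
  have hx : SemiconjBy x (z * w * z⁻¹) (z * w * z⁻¹) :=
    (hxz.mul_right hxw).mul_right hxz.inv_right
  have := hx.mul_left (hy.mul_left (hz.mul_left hw))
  rwa [show (x * y * x⁻¹)⁻¹ * (x * z * w⁻¹) = x * (y⁻¹ * (z * w⁻¹)) by group]

theorem mem_of_semiconjBy {G : Subgroup M} {f c d : M} (h : SemiconjBy f c d) (hf : f ∈ G)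
    (hc : c ∈ G) : d ∈ G := by
  rw [← mul_inv_eq_iff_eq_mul.mpr h.eq]
  exact G.mul_mem (G.mul_mem hf hc) (G.inv_mem hf)

theorem mem_of_braid_chain {G : Subgroup M}
    (hxy : x * y * x = y * x * y) (hyz : y * z * y = z * y * z) (hzw : z * w * z = w * z * w)
    (hxz : Commute x z) (hxw : Commute x w) (hyw : Commute y w)
    (hPx : Commute P x) (hPy : Commute P y) (hPz : Commute P z) (hPw : Commute P w)
    (hRx : Commute R x) (hRy : Commute R y) (hRz : Commute R z)
    (hc : x * y * x⁻¹ ∈ G) (hF : P * (x * (z * w⁻¹ * R)) ∈ G) :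
    y * z * y⁻¹ ∈ G ∧ z * w * z⁻¹ ∈ G := by
  have hPd : Commute P (y * z * y⁻¹) := (hPy.mul_right hPz).mul_right hPy.inv_right
  have hRd : Commute R (y * z * y⁻¹) := (hRy.mul_right hRz).mul_right hRy.inv_right
  have hPc : Commute P (x * y * x⁻¹) := (hPx.mul_right hPy).mul_right hPx.inv_right
  have hRc : Commute R (x * y * x⁻¹) := (hRx.mul_right hRy).mul_right hRx.inv_right
  have hwc : Commute w⁻¹ (x * y * x⁻¹) :=
    ((hxw.symm.mul_right hyw.symm).mul_right hxw.symm.inv_right).inv_left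
  have hPxz : Commute P (x * z) := hPx.mul_right hPz
  have hd : y * z * y⁻¹ ∈ G := by
    refine mem_of_semiconjBy ?_ (G.mul_mem hc hF) hc
    have := (semiconjBy_braid_chain_three hxy hyz hxz).mul_left
      (SemiconjBy.mul_left hPc (SemiconjBy.mul_left hwc hRc))
    rwa [show x * y * x⁻¹ * (P * (x * (z * w⁻¹ * R)))
      = x * y * x⁻¹ * (P * (x * z)) * (w⁻¹ * R) by group, hPxz.eq,
      show x * y * x⁻¹ * (x * z * P) * (w⁻¹ * R)
      = x * y * x⁻¹ * (x * z) * (P * (w⁻¹ * R)) by group]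
  refine ⟨hd, mem_of_semiconjBy ?_ (G.mul_mem (G.inv_mem hc) hF) hd⟩
  have := (semiconjBy_braid_chain_four hyz hzw hxz hxw hyw).mul_left
    (SemiconjBy.mul_left hPd hRd)
  rwa [show (x * y * x⁻¹)⁻¹ * (P * (x * (z * w⁻¹ * R)))
    = (x * y * x⁻¹)⁻¹ * (P * (x * z * w⁻¹)) * R by group, (hPxz.mul_right hPw.inv_right).eq,
    show (x * y * x⁻¹)⁻¹ * (x * z * w⁻¹ * P) * R
    = (x * y * x⁻¹)⁻¹ * (x * z * w⁻¹) * (P * R) by group]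

end GroupIdentities

theorem commute_list_prod_map_range {a : M} {n : ℕ} {f : ℕ → M}
    (h : ∀ j < n, Commute (f j) a) : Commute ((List.range n).map f).prod a := by
  refine (Commute.list_prod_right _ _ fun y hy => ?_).symm
  obtain ⟨j, hj, rfl⟩ := List.mem_map.mp hy
  exact (h j (List.mem_range.mp hj)).symm

theorem oddTail_eq_mul (tw : Curve → M) (α : ℕ → Curve) {g i : ℕ} (hi : i < g) :
    oddTail tw α g i
      = tw (α (2 * i - 1)) * (tw (α (2 * i)))⁻¹ * oddTail tw α g (i + 1) := by
  unfold oddTail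
  rw [show g - i + 1 = (g - (i + 1) + 1) + 1 by omega, List.range_succ_eq_map, List.map_cons,
    List.prod_cons, List.map_map]
  congr 3
  funext j
  simp [Nat.add_assoc, Nat.add_comm 1]

theorem oddTail_self (tw : Curve → M) (α : ℕ → Curve) (g : ℕ) :
    oddTail tw α g g = tw (α (2 * g - 1)) * (tw (α (2 * g)))⁻¹ := by
  simp [oddTail]

/-- **Lemma 6 (Hirose–Monden).**
Let `g ≥ 4`, let `G` be the subgroup of `M_g` generated by `f₁` and `f₂`, and set
`F_{2k-1} = t_{α_3} t_{α_5} ⋯ t_{α_{2k-3}} f_{2k-1}` for `3 ≤ k ≤ g`.  Suppose that for some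
`i` with `3 ≤ i ≤ g-1` the elements `t_{γ_{2i-1}}`, `F_{2i-1}`, `F_{2i+1}` lie in `G`
(where `γ_j = t_{α_j}(α_{j+1})`).  Then:
(1) `t_{γ_{2i}}` and `t_{γ_{2i+1}}` lie in `G`;
(2) `F_{2i+3}` lies in `G` if `i ≤ g-2`; and
(3) `t_{α_{2g}}` lies in `G` if `i = g-1`. -/
theorem step_lemma
    (g : ℕ) (hg : 4 ≤ g)
    (M : Type) [Group M] (Curve : Type)
    (act : M → Curve → Curve)
    (act_one : ∀ x : Curve, act 1 x = x)
    (act_mul : ∀ f h : M, ∀ x : Curve, act (f * h) x = act f (act h x))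
    (tw : Curve → M)
    (tw_conj : ∀ (f : M) (x : Curve), tw (act f x) = f * tw x * f⁻¹)
    (α : ℕ → Curve) (β : Curve)
    (h_braid : ∀ i, 1 ≤ i → i ≤ 2*g →
      tw (α i) * tw (α (i+1)) * tw (α i) = tw (α (i+1)) * tw (α i) * tw (α (i+1)))
    (h_comm : ∀ i j, 1 ≤ i → i + 1 < j → j ≤ 2*g+1 → Commute (tw (α i)) (tw (α j)))
    (h_beta_comm : ∀ i, 1 ≤ i → i ≤ 2*g+1 → i ≠ 4 → Commute (tw β) (tw (α i)))
    (h_beta_braid : tw β * tw (α 4) * tw β = tw (α 4) * tw β * tw (α 4))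
    (G : Subgroup M)
    (hG : G = Subgroup.closure ({fOdd tw α β g 1, fEven tw α β g 1} : Set M))
    (i : ℕ) (hi₁ : 3 ≤ i) (hi₂ : i ≤ g - 1)
    (hγ : tw (act (tw (α (2*i - 1))) (α (2*i))) ∈ G)
    (hF₁ : F tw α β g i ∈ G)
    (hF₂ : F tw α β g (i+1) ∈ G) :
    (tw (act (tw (α (2*i))) (α (2*i + 1))) ∈ G ∧
      tw (act (tw (α (2*i + 1))) (α (2*i + 2))) ∈ G) ∧
    (i ≤ g - 2 → F tw α β g (i+2) ∈ G) ∧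
    (i = g - 1 → tw (α (2*g)) ∈ G) := by
  simp only [tw_conj] at hγ ⊢
  obtain ⟨R, hR, hRcomm, hRtop, hRlt⟩ : ∃ R : M,
      oddTail tw α g (i + 1) = tw (α (2 * i + 1)) * (tw (α (2 * i + 2)))⁻¹ * R ∧
      (∀ k, 1 ≤ k → k ≤ 2 * i + 1 → Commute R (tw (α k))) ∧
      (i = g - 1 → R = 1) ∧ (i ≤ g - 2 → R = oddTail tw α g (i + 2)) := by
    rcases eq_or_lt_of_le (show i + 1 ≤ g by omega) with rfl | hlt
    · exact ⟨1, by simp [oddTail_self, Nat.mul_add], fun _ _ _ => Commute.one_left _,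
        fun _ => rfl, fun h => by omega⟩
    · refine ⟨oddTail tw α g (i + 2), oddTail_eq_mul tw α hlt, fun k hk hk' => ?_,
        fun h => by omega, fun _ => rfl⟩
      refine commute_list_prod_map_range fun j hj => ?_
      exact (h_comm k _ hk (by omega) (by omega)).symm.mul_left
        (h_comm k _ hk (by omega) (by omega)).symm.inv_left
  set p := ((List.range (i - 2)).map fun j => tw (α (2*j + 3))).prod with hp
  have hpcomm (k : ℕ) (hk : 2 * i - 1 ≤ k) (hk' : k ≤ 2 * g + 1) : Commute p (tw (α k)) :=
    commute_list_prod_map_range fun j hj => h_comm _ k (by omega) (by omega) hk'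
  have hPcomm (k : ℕ) (hk : 2 * i - 1 ≤ k) (hk' : k ≤ 2 * g + 1) :
      Commute (p * tw β) (tw (α k)) :=
    (hpcomm k hk hk').mul_left (h_beta_comm k (by omega) hk' (by omega))
  have hp₁ : ((List.range (i + 1 - 2)).map fun j => tw (α (2*j + 3))).prod
      = p * tw (α (2 * i - 1)) := by
    rw [show i + 1 - 2 = i - 2 + 1 by omega, List.range_succ, List.map_append, List.prod_append,
      ← hp]
    simp [show 2 * (i - 2) + 3 = 2 * i - 1 by omega]
  have hp₂ : ((List.range (i + 2 - 2)).map fun j => tw (α (2*j + 3))).prod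
      = p * tw (α (2 * i - 1)) * tw (α (2 * i + 1)) := by
    rw [show i + 2 - 2 = i + 1 - 2 + 1 by omega, List.range_succ, List.map_append,
      List.prod_append, hp₁]
    simp [show 2 * (i - 1) + 3 = 2 * i + 1 by omega]
  have hβx : Commute (tw β) (tw (α (2 * i - 1))) :=
    h_beta_comm _ (by omega) (by omega) (by omega)
  have hβz : Commute (tw β) (tw (α (2 * i + 1))) :=
    h_beta_comm _ (by omega) (by omega) (by omega)
  have hF₃ : F tw α β g (i + 1) = p * tw β * (tw (α (2 * i - 1)) *
      (tw (α (2 * i + 1)) * (tw (α (2 * i + 2)))⁻¹ * R)) := by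
    unfold F fOdd
    rw [hp₁, hR, mul_assoc p, ← mul_assoc (tw (α (2 * i - 1))), ← hβx.eq]
    simp only [mul_assoc]
  rw [hF₃] at hF₂
  have hxy := h_braid (2 * i - 1) (by omega) (by omega)
  rw [show 2 * i - 1 + 1 = 2 * i by omega] at hxy
  have hxz : Commute (tw (α (2 * i - 1))) (tw (α (2 * i + 1))) :=
    h_comm _ _ (by omega) (by omega) (by omega)
  have hxw : Commute (tw (α (2 * i - 1))) (tw (α (2 * i + 2))) :=
    h_comm _ _ (by omega) (by omega) (by omega)
  obtain ⟨hd, he⟩ := mem_of_braid_chain hxy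
    (h_braid (2 * i) (by omega) (by omega)) (h_braid (2 * i + 1) (by omega) (by omega))
    hxz hxw (h_comm _ _ (by omega) (by omega) (by omega))
    (hPcomm _ (by omega) (by omega)) (hPcomm _ (by omega) (by omega))
    (hPcomm _ (by omega) (by omega)) (hPcomm _ (by omega) (by omega))
    (hRcomm _ (by omega) (by omega)) (hRcomm _ (by omega) (by omega))
    (hRcomm _ (by omega) (by omega)) hγ hF₂
  have hPxe : Commute (p * tw β * tw (α (2 * i - 1)))
      (tw (α (2 * i + 1)) * tw (α (2 * i + 2)) * (tw (α (2 * i + 1)))⁻¹) := by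
    have hz := (hPcomm (2 * i + 1) (by omega) (by omega)).mul_left hxz
    have hw := (hPcomm (2 * i + 2) (by omega) (by omega)).mul_left hxw
    exact (hz.mul_right hw).mul_right hz.inv_right
  refine ⟨⟨hd, he⟩, fun h => ?_, fun h => ?_⟩
  · have hF₄ : F tw α β g (i + 2) =
        tw (α (2 * i + 1)) * tw (α (2 * i + 2)) * (tw (α (2 * i + 1)))⁻¹ *
        (p * tw β * (tw (α (2 * i - 1)) *
          (tw (α (2 * i + 1)) * (tw (α (2 * i + 2)))⁻¹ * R))) := by
      unfold F fOdd
      calc _ = p * (tw (α (2 * i - 1)) * tw (α (2 * i + 1)) * tw β) * R := by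
            rw [hp₂, hRlt h]; group
        _ = p * tw β * tw (α (2 * i - 1)) *
            (tw (α (2 * i + 1)) * tw (α (2 * i + 2)) * (tw (α (2 * i + 1)))⁻¹) *
            (tw (α (2 * i + 1)) * (tw (α (2 * i + 2)))⁻¹ * R) := by
            rw [← (hβx.mul_right hβz).eq]; group
        _ = _ := by rw [hPxe.eq]; group
    rw [hF₄]
    exact G.mul_mem he hF₂
  · have hw : SemiconjBy (p * tw β * (tw (α (2 * i - 1)) *
        (tw (α (2 * i + 1)) * (tw (α (2 * i + 2)))⁻¹ * R))) (tw (α (2 * i + 2)))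
        (tw (α (2 * i + 1)) * tw (α (2 * i + 2)) * (tw (α (2 * i + 1)))⁻¹) := by
      rw [hRtop h, mul_one, ← mul_assoc]
      refine SemiconjBy.mul_left hPxe (SemiconjBy.mul_left ?_ (Commute.refl _).inv_left)
      simp [SemiconjBy, mul_assoc]
    rw [show 2 * g = 2 * i + 2 by omega]
    exact mem_of_semiconjBy hw.inv_symm_left (G.inv_mem hF₂) he

end HumphriesStmt11
end

section
/- Let k be a positive integer, g ≥ k + 6, and let f ∈ M_g satisfy f^j(a_k, b_k, c_k) = (a_{k+j}, b_{k+j}, c_{k+j}) for j = 1, 2, 3, 4 and f(c_{k+4}) = c_{k+5}. If G'' is the subgroup of M_g generated by f and the element t_{b_k} t_{a_{k+2}}^{-1} t_{c_{k+3}} · t_{c_{k+4}}^{-1} t_{a_{k+3}} t_{b_{k+1}}^{-1}, then the elements t_{a_k} t_{a_{k+1}}^{-1}, t_{b_k} t_{b_{k+1}}^{-1}, and t_{c_k} t_{c_{k+1}}^{-1} all belong to G''. -/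
namespace LickorishStmt19

section Group

variable {G : Type*} [Group G]

open scoped commutatorElement

/-- For elements satisfying the braid relation, `⁅x, y⁆ = y⁻¹ * x`. -/
theorem commutator_eq_of_braid {x y : G} (h : x * y * x = y * x * y) : ⁅x, y⁆ = y⁻¹ * x := by
  rw [commutatorElement_def, mul_inv_eq_iff_eq_mul, mul_inv_eq_iff_eq_mul, mul_assoc, mul_assoc,
    eq_inv_mul_iff_mul_eq]
  simpa only [mul_assoc] using h.symm

/-- The braid relation passes to inverses. -/
theorem braid_inv {x y : G} (h : x * y * x = y * x * y) :
    x⁻¹ * y⁻¹ * x⁻¹ = y⁻¹ * x⁻¹ * y⁻¹ := by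
  simpa only [mul_inv_rev, mul_assoc] using congrArg Inv.inv h

/-- Factors commuting with the other side drop out of a commutator. -/
theorem commutator_mul_mul {x y z u : G} (hz : Commute z (y * u)) (hu : Commute u x) :
    ⁅x * z, y * u⁆ = ⁅x, y⁆ := by
  have h1 : z * (y * u) * z⁻¹ = y * u := by rw [hz.eq, mul_inv_cancel_right]
  have h2 : u * x⁻¹ * u⁻¹ = x⁻¹ := by rw [hu.inv_right.eq, mul_inv_cancel_right]
  calc ⁅x * z, y * u⁆ = x * (z * (y * u) * z⁻¹) * x⁻¹ * (y * u)⁻¹ := by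
        rw [commutatorElement_def]; group
    _ = x * y * (u * x⁻¹ * u⁻¹) * y⁻¹ := by rw [h1]; group
    _ = ⁅x, y⁆ := by rw [h2, commutatorElement_def]

/-- A subgroup contains every commutator of its elements, here with the commuting factors removed
and the braid relation applied. -/
theorem inv_mul_mem_of_braid {H : Subgroup G} {x y z u : G} (hx : x * z ∈ H) (hy : y * u ∈ H)
    (hz : Commute z (y * u)) (hu : Commute u x) (h : x * y * x = y * x * y) : y⁻¹ * x ∈ H := by
  rw [← commutator_eq_of_braid h, ← commutator_mul_mul hz hu, commutatorElement_def]
  exact H.mul_mem (H.mul_mem (H.mul_mem hx hy) (H.inv_mem hx)) (H.inv_mem hy)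

/-- Conjugating by an element of a subgroup does not affect membership. -/
theorem conj_mem_iff {H : Subgroup G} {f x : G} (hf : f ∈ H) : f * x * f⁻¹ ∈ H ↔ x ∈ H := by
  rw [H.mul_mem_cancel_right (H.inv_mem hf), H.mul_mem_cancel_left hf]

/-- The group-theoretic content of the theorem: `A`, `B`, `C` are the twists about consecutive
Lickorish curves, and `f` shifts their indices. -/
theorem differences_mem_of_shift {H : Subgroup G} {f : G} {A B C : ℕ → G} (hf : f ∈ H)
    (hA : ∀ j ≤ 3, f * A j * f⁻¹ = A (j + 1)) (hB : ∀ j ≤ 3, f * B j * f⁻¹ = B (j + 1))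
    (hC : ∀ j ≤ 4, f * C j * f⁻¹ = C (j + 1))
    (hab : ∀ i, A i * B i * A i = B i * A i * B i)
    (hbc : ∀ i, B i * C i * B i = C i * B i * C i)
    (hcb : ∀ i, C i * B (i + 1) * C i = B (i + 1) * C i * B (i + 1))
    (haa : ∀ i j, Commute (A i) (A j)) (hcc : ∀ i j, Commute (C i) (C j))
    (hac : ∀ i j, Commute (A i) (C j))
    (hbb : ∀ i ≤ 5, ∀ j ≤ 5, Commute (B i) (B j))
    (hab' : ∀ i ≤ 5, ∀ j ≤ 5, i ≠ j → Commute (A i) (B j))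
    (hbc' : ∀ i ≤ 5, ∀ j ≤ 5, j ≠ i → j + 1 ≠ i → Commute (B i) (C j))
    (hx : B 0 * (A 2)⁻¹ * C 3 * (C 4)⁻¹ * A 3 * (B 1)⁻¹ ∈ H) :
    A 0 * (A 1)⁻¹ ∈ H ∧ B 0 * (B 1)⁻¹ ∈ H ∧ C 0 * (C 1)⁻¹ ∈ H := by
  have hca : ∀ i j, Commute (C i) (A j) := fun i j => (hac j i).symm
  have hba' : ∀ i ≤ 5, ∀ j ≤ 5, i ≠ j → Commute (B i) (A j) :=
    fun i hi j hj h => (hab' j hj i hi h.symm).symm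
  have hcb' : ∀ i ≤ 5, ∀ j ≤ 5, i ≠ j → i + 1 ≠ j → Commute (C i) (B j) :=
    fun i hi j hj h h' => (hbc' j hj i hi h h').symm
  have shift : ∀ {U V : ℕ → G}, (∀ j ≤ 3, f * U j * f⁻¹ = U (j + 1)) →
      (∀ j ≤ 3, f * V j * f⁻¹ = V (j + 1)) →
      ∀ j ≤ 4, (U j * V j ∈ H ↔ U 0 * V 0 ∈ H) := by
    intro U V hU hV j hj
    induction j with
    | zero => rfl
    | succ j ih =>
      rw [← ih (by lia), ← hU j (by lia), ← hV j (by lia), conj_mul, conj_mem_iff hf]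
  have inv : ∀ {U : ℕ → G}, (∀ j ≤ 3, f * U j * f⁻¹ = U (j + 1)) →
      ∀ j ≤ 3, f * (U j)⁻¹ * f⁻¹ = (U (j + 1))⁻¹ := by
    intro U hU j hj
    rw [← hU j hj, conj_inv]
  have hy : B 1 * (A 3)⁻¹ * C 4 * (C 5)⁻¹ * A 4 * (B 2)⁻¹ ∈ H := by
    rw [← conj_mem_iff hf] at hx
    simpa only [← conj_mul, ← conj_inv, hA 2 (by lia), hA 3 (by lia), hB 0 (by lia),
      hB 1 (by lia), hC 3 (by lia), hC 4 (by lia)] using hx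
  have comm₁ : Commute (B 0 * C 3 * (C 4)⁻¹ * A 3 * (B 1)⁻¹)
      (B 1 * (A 3)⁻¹ * C 4 * (C 5)⁻¹ * A 4 * (B 2)⁻¹) := by
    repeat' first | apply Commute.mul_left | apply Commute.mul_right
    all_goals simp [haa, hcc, hac, hca, hbb, hab', hba', hbc', hcb']
  have comm₂ : Commute (A 2) (B 0 * C 3 * (C 4)⁻¹ * A 3 * (B 1)⁻¹) := by
    repeat' first | apply Commute.mul_left | apply Commute.mul_right
    all_goals simp [haa, hac, hab']
  have comm₃ : Commute (B 2) (B 1 * (A 3)⁻¹ * C 4 * (C 5)⁻¹ * A 4) := by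
    repeat' first | apply Commute.mul_left | apply Commute.mul_right
    all_goals simp [hbb, hba', hbc']
  have comm₄ : Commute (B 1 * (A 3)⁻¹ * C 4 * (C 5)⁻¹ * A 4) (A 2) := by
    repeat' first | apply Commute.mul_left | apply Commute.mul_right
    all_goals simp [haa, hca, hba']
  set Z := B 0 * C 3 * (C 4)⁻¹ * A 3 * (B 1)⁻¹ with hZ
  set U := B 1 * (A 3)⁻¹ * C 4 * (C 5)⁻¹ * A 4 with hU
  have hx' : (A 2)⁻¹ * Z ∈ H := by
    rwa [hZ, ← mul_assoc, ← mul_assoc, ← mul_assoc, ← mul_assoc,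
      ← (hba' 0 (by lia) 2 (by lia) (by lia)).inv_right.eq]
  rw [← comm₃.inv_left.eq] at hy comm₁
  have hx'' : A 2 * Z⁻¹ ∈ H := by
    have h := H.inv_mem hx'
    rwa [mul_inv_rev, inv_inv, ← comm₂.inv_right.eq] at h
  have hy' : B 2 * U⁻¹ ∈ H := by
    have h := H.inv_mem hy
    rwa [mul_inv_rev, inv_inv, ← comm₃.inv_right.eq] at h
  have comm₁' : Commute Z⁻¹ (B 2 * U⁻¹) := by
    have h := comm₁.inv_inv
    rwa [mul_inv_rev (B 2)⁻¹, inv_inv, ← comm₃.inv_right.eq] at h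
  have hba₂ : B 2 * (A 2)⁻¹ ∈ H := by
    simpa only [inv_inv] using
      inv_mul_mem_of_braid hx' hy comm₁ comm₄.inv_right (braid_inv (hab 2))
  have hab₂ : (B 2)⁻¹ * A 2 ∈ H := inv_mul_mem_of_braid hx'' hy' comm₁' comm₄.inv_left (hab 2)
  have hba : ∀ j ≤ 4, B j * (A j)⁻¹ ∈ H := fun j hj =>
    (shift hB (inv hA) j hj).2 ((shift hB (inv hA) 2 (by lia)).1 hba₂)
  have hiab : ∀ j ≤ 4, (B j)⁻¹ * A j ∈ H := fun j hj =>
    (shift (inv hB) hA j hj).2 ((shift (inv hB) hA 2 (by lia)).1 hab₂)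
  have hbc₃ : (B 3)⁻¹ * C 3 ∈ H := by
    refine inv_mul_mem_of_braid (z := B 0 * (A 2)⁻¹ * (C 5)⁻¹ * A 4 * (B 2)⁻¹) ?_
      (hba 3 (by lia)) ?_ (hac 3 3).inv_left (hbc 3).symm
    · have hxy : B 0 * (A 2)⁻¹ * C 3 * (C 4)⁻¹ * A 3 * (B 1)⁻¹ *
          (B 1 * (A 3)⁻¹ * C 4 * (C 5)⁻¹ * A 4 * (B 2)⁻¹) =
          C 3 * (B 0 * (A 2)⁻¹ * (C 5)⁻¹ * A 4 * (B 2)⁻¹) := by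
        have h : Commute (C 3) (B 0 * (A 2)⁻¹) := by
          simp [Commute.mul_right, hca, hcb']
        calc _ = B 0 * (A 2)⁻¹ * C 3 * ((C 5)⁻¹ * A 4 * (B 2)⁻¹) := by group
          _ = _ := by rw [← h.eq]; group
      rw [← hxy]
      refine H.mul_mem hx ?_
      rwa [← hU, ← comm₃.inv_left.eq]
    · repeat' first | apply Commute.mul_left | apply Commute.mul_right
      all_goals simp [haa, hca, hbb, hab', hba', hcb']
  have hac₃ : (A 3)⁻¹ * C 3 ∈ H := by
    have h := H.mul_mem (H.inv_mem (hiab 3 (by lia))) hbc₃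
    rwa [mul_inv_rev, inv_inv, mul_assoc, mul_inv_cancel_left] at h
  have hiac : ∀ j ≤ 4, (A j)⁻¹ * C j ∈ H := fun j hj =>
    have hC' : ∀ j ≤ 3, f * C j * f⁻¹ = C (j + 1) := fun j hj => hC j (by lia)
    (shift (inv hA) hC' j hj).2 ((shift (inv hA) hC' 3 (by lia)).1 hac₃)
  have hcb₀ : (B 1)⁻¹ * C 0 ∈ H := by
    have h : Commute (A 0)⁻¹ (B 1 * (A 1)⁻¹) :=
      ((hab' 0 (by lia) 1 (by lia) (by lia)).mul_right (haa 0 1).inv_right).inv_left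
    exact inv_mul_mem_of_braid ((hca 0 0).inv_right.eq ▸ hiac 0 (by lia)) (hba 1 (by lia)) h
      (hac 1 0).inv_left (hcb 0)
  have haa₀ : A 0 * (A 1)⁻¹ ∈ H := by
    have h := H.mul_mem (hiac 0 (by lia)) (H.mul_mem (H.inv_mem hcb₀) (hiab 1 (by lia)))
    have h' := H.inv_mem h
    rwa [show (A 0)⁻¹ * C 0 * (((B 1)⁻¹ * C 0)⁻¹ * ((B 1)⁻¹ * A 1)) = (A 0)⁻¹ * A 1 by group,
      mul_inv_rev, inv_inv, ← (haa 0 1).inv_right.eq] at h'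
  refine ⟨haa₀, ?_, ?_⟩
  · have h := H.mul_mem (H.mul_mem (hba 0 (by lia)) haa₀) (H.inv_mem (hba 1 (by lia)))
    rwa [show B 0 * (A 0)⁻¹ * (A 0 * (A 1)⁻¹) * (B 1 * (A 1)⁻¹)⁻¹ = B 0 * (B 1)⁻¹ by group] at h
  · have hca' : ∀ j ≤ 4, C j * (A j)⁻¹ ∈ H := fun j hj => (hca j j).inv_right.eq ▸ hiac j hj
    have h := H.mul_mem (H.mul_mem (hca' 0 (by lia)) haa₀) (H.inv_mem (hca' 1 (by lia)))
    rwa [show C 0 * (A 0)⁻¹ * (A 0 * (A 1)⁻¹) * (C 1 * (A 1)⁻¹)⁻¹ = C 0 * (C 1)⁻¹ by group] at h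

end Group

/-- **Lemma 9 (Hirose–Monden).**
Let `k` be a positive integer, `g ≥ k + 6`, and let `f ∈ M_g` satisfy
`f^j(a_k, b_k, c_k) = (a_{k+j}, b_{k+j}, c_{k+j})` for `j = 1, 2, 3, 4` and
`f(c_{k+4}) = c_{k+5}`.  If `G''` is the subgroup of `M_g` generated by `f` and
`t_{b_k} t_{a_{k+2}}⁻¹ t_{c_{k+3}} ⋅ t_{c_{k+4}}⁻¹ t_{a_{k+3}} t_{b_{k+1}}⁻¹`, then the
elements `t_{a_k} t_{a_{k+1}}⁻¹`, `t_{b_k} t_{b_{k+1}}⁻¹`, `t_{c_k} t_{c_{k+1}}⁻¹` all belong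
to `G''`.

Setting: `M` is the mapping class group of `Σ_g`, acting (via `act`) on isotopy classes of
simple closed curves, with `t_{f(c)} = f t_c f⁻¹`; `a i, b i, c i` (`i ∈ ZMod g`) are the
standard Lickorish curves, permuted cyclically by the rotation `r` (with `r^g = 1`), with the
associated braid and commutation relations. -/
theorem twist_differences_in_G''
    (g : ℕ) (k : ℕ) (hk : 1 ≤ k) (hg : k + 6 ≤ g)
    (M : Type) [Group M] (Curve : Type)
    (act : M → Curve → Curve)
    (act_one : ∀ x : Curve, act 1 x = x)
    (act_mul : ∀ f h : M, ∀ x : Curve, act (f * h) x = act f (act h x))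
    (tw : Curve → M)
    (tw_conj : ∀ (f : M) (x : Curve), tw (act f x) = f * tw x * f⁻¹)
    (a b c : ZMod g → Curve)
    (r : M)                              -- the rotation by -2π/g about the x-axis
    (hra : ∀ i : ZMod g, act r (a i) = a (i + 1))
    (hrb : ∀ i : ZMod g, act r (b i) = b (i + 1))
    (hrc : ∀ i : ZMod g, act r (c i) = c (i + 1))
    (hrg : r ^ g = 1)
    -- braid relations coming from curves intersecting once:
    (h_ab : ∀ i : ZMod g, tw (a i) * tw (b i) * tw (a i) = tw (b i) * tw (a i) * tw (b i))
    (h_bc : ∀ i : ZMod g, tw (b i) * tw (c i) * tw (b i) = tw (c i) * tw (b i) * tw (c i))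
    (h_cb : ∀ i : ZMod g,
      tw (c i) * tw (b (i+1)) * tw (c i) = tw (b (i+1)) * tw (c i) * tw (b (i+1)))
    -- commutation relations coming from disjoint curves:
    (h_aa : ∀ i j : ZMod g, Commute (tw (a i)) (tw (a j)))
    (h_cc : ∀ i j : ZMod g, Commute (tw (c i)) (tw (c j)))
    (h_ac : ∀ i j : ZMod g, Commute (tw (a i)) (tw (c j)))
    (h_bb : ∀ i j : ZMod g, i ≠ j → Commute (tw (b i)) (tw (b j)))
    (h_ab' : ∀ i j : ZMod g, i ≠ j → Commute (tw (a i)) (tw (b j)))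
    (h_bc' : ∀ i j : ZMod g, j ≠ i → j ≠ i - 1 → Commute (tw (b i)) (tw (c j)))
    (f : M)
    (hfa : ∀ j : ℕ, 1 ≤ j → j ≤ 4 → act (f ^ j) (a (k : ZMod g)) = a ((k+j : ℕ) : ZMod g))
    (hfb : ∀ j : ℕ, 1 ≤ j → j ≤ 4 → act (f ^ j) (b (k : ZMod g)) = b ((k+j : ℕ) : ZMod g))
    (hfc : ∀ j : ℕ, 1 ≤ j → j ≤ 4 → act (f ^ j) (c (k : ZMod g)) = c ((k+j : ℕ) : ZMod g))
    (hfc' : act f (c ((k+4 : ℕ) : ZMod g)) = c ((k+5 : ℕ) : ZMod g))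
    (G'' : Subgroup M)
    (hG'' : G'' = Subgroup.closure
      ({f, tw (b (k : ZMod g)) * (tw (a ((k+2 : ℕ) : ZMod g)))⁻¹ * tw (c ((k+3 : ℕ) : ZMod g)) *
          (tw (c ((k+4 : ℕ) : ZMod g)))⁻¹ * tw (a ((k+3 : ℕ) : ZMod g)) *
          (tw (b ((k+1 : ℕ) : ZMod g)))⁻¹} : Set M)) :
    tw (a (k : ZMod g)) * (tw (a ((k+1 : ℕ) : ZMod g)))⁻¹ ∈ G'' ∧
    tw (b (k : ZMod g)) * (tw (b ((k+1 : ℕ) : ZMod g)))⁻¹ ∈ G'' ∧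
    tw (c (k : ZMod g)) * (tw (c ((k+1 : ℕ) : ZMod g)))⁻¹ ∈ G'' := by
  subst hG''
  have hne : ∀ i ≤ 6, ∀ j ≤ 6, i ≠ j → ((k + i : ℕ) : ZMod g) ≠ ((k + j : ℕ) : ZMod g) := by
    intro i hi j hj hij h
    rw [ZMod.natCast_eq_natCast_iff] at h
    exact hij ((Nat.ModEq.add_left_cancel' k h).eq_of_lt_of_lt (by lia) (by lia))
  have hact : ∀ d : ZMod g → Curve,
      (∀ j : ℕ, 1 ≤ j → j ≤ 4 → act (f ^ j) (d (k : ZMod g)) = d ((k + j : ℕ) : ZMod g)) →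
      ∀ j ≤ 3, f * tw (d ((k + j : ℕ) : ZMod g)) * f⁻¹ = tw (d ((k + (j + 1) : ℕ) : ZMod g)) := by
    intro d hd j hj
    rw [← tw_conj, ← hd (j + 1) (by lia) (by lia)]
    rcases Nat.eq_zero_or_pos j with rfl | hpos
    · rw [zero_add, pow_one, add_zero]
    · rw [← hd j hpos (by lia), ← act_mul, pow_succ']
  refine differences_mem_of_shift (f := f) (A := fun i => tw (a ((k + i : ℕ) : ZMod g)))
    (B := fun i => tw (b ((k + i : ℕ) : ZMod g))) (C := fun i => tw (c ((k + i : ℕ) : ZMod g)))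
    (Subgroup.subset_closure (by simp)) (hact a hfa) (hact b hfb) ?_ (fun i => h_ab _)
    (fun i => h_bc _) ?_ (fun i j => h_aa _ _) (fun i j => h_cc _ _) (fun i j => h_ac _ _)
    ?_ ?_ ?_ (Subgroup.subset_closure (by simp))
  · intro j hj
    rcases Nat.lt_or_eq_of_le hj with hlt | rfl
    · exact hact c hfc j (by lia)
    · rw [← tw_conj, hfc']
  · intro i
    simpa only [Nat.cast_add, Nat.cast_one, add_assoc] using h_cb ((k + i : ℕ) : ZMod g)
  · intro i hi j hj
    rcases eq_or_ne i j with rfl | hij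
    · exact Commute.refl _
    · exact h_bb _ _ (hne i (by lia) j (by lia) hij)
  · exact fun i hi j hj hij => h_ab' _ _ (hne i (by lia) j (by lia) hij)
  · intro i hi j hj hij hij'
    refine h_bc' _ _ (hne j (by lia) i (by lia) hij) fun h => ?_
    refine hne (j + 1) (by lia) i (by lia) hij' ?_
    rw [← add_assoc, Nat.cast_succ, h, sub_add_cancel]

end LickorishStmt19
end
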